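/- arXiv:2103.05369 — 2 statements merged into one kernel-verified Lean document; each statement's English description precedes it below -/
import Mathlib

section
/- Threshold condition for the collocation solution: Let s ≥ 1 be an integer, T > 0, and let u : [0,2π]×[0,T] → ℝ be a classical solution of the periodic problem ∂u/∂τ = A ∂²u/∂x² + B ∂u/∂x + C (∂u/∂x)² with periodic boundary conditions, A > 0, B, C ∈ ℝ, such that for every τ ∈ [0,T], u(·,τ) ∈ H^{s+2}_p and u_τ(·,τ) ∈ H^s_p with max_{0≤τ≤T}‖∂^{s+1}u/∂x^{s+1}‖, max_{0≤τ≤T}‖∂^{s+2}u/∂x^{s+2}‖ and max_{0≤τ≤T}‖∂^s u_τ/∂x^s‖ finite. For each N, let u^N : [0,T] → S_N be a continuously differentiable solution of the collocation equations ∂_τ u^N(x_j,τ) = A ∂²_x u^N(x_j,τ) + B ∂_x u^N(x_j,τ) + C(∂_x u^N(x_j,τ))² for j = 0,…,2N−1 and τ ∈ [0,T], with u^N(x_j,0) = u(x_j,0). Then there exist a constant M and an integer N₀ such that for all N ≥ N₀ and all τ ∈ [0,T], ‖∂_x u^N(·,τ)‖_∞ ≤ M. -/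
open Real MeasureTheory

noncomputable section

/-- Equispaced nodes `x_j = jπ/N`. -/
def node (N : ℕ) (j : ℕ) : ℝ := j * Real.pi / N

/-- The trigonometric polynomial `x ↦ Σ_{k=-N}^{N-1} c_k e^{ikx}`. -/
def trigPoly (N : ℕ) (c : ℤ → ℂ) : ℝ → ℂ := fun x =>
  ∑ k ∈ Finset.Icc (-(N : ℤ)) ((N : ℤ) - 1), c k * Complex.exp (Complex.I * k * x)

/-- Membership in the space `S_N` of trigonometric polynomials of degree `N`. -/
def memSN (N : ℕ) (v : ℝ → ℂ) : Prop := ∃ c : ℤ → ℂ, v = trigPoly N c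

/-- Discrete Fourier transform coefficients of `u` at the `2N` equispaced nodes. -/
def dftCoeff (N : ℕ) (u : ℝ → ℂ) (k : ℤ) : ℂ :=
  (1 / (2 * N : ℂ)) *
    ∑ j ∈ Finset.range (2 * N), u (node N j) * Complex.exp (-(Complex.I * k * node N j))

/-- The trigonometric interpolant `I_N(u) ∈ S_N` of `u` at the equispaced nodes. -/
def interp (N : ℕ) (u : ℝ → ℂ) : ℝ → ℂ := trigPoly N (dftCoeff N u)

/-- The `L²(0, 2π)` norm. -/
def l2norm {E : Type*} [NormedAddCommGroup E] (v : ℝ → E) : ℝ :=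
  Real.sqrt (∫ x in (0:ℝ)..(2 * Real.pi), ‖v x‖ ^ 2)

/-- The sup norm over `[0, 2π]`. -/
def supNorm {E : Type*} [NormedAddCommGroup E] (v : ℝ → E) : ℝ :=
  ⨆ x : Set.Icc (0:ℝ) (2 * Real.pi), ‖v x.1‖

/-- `u` has the (pointwise convergent) Fourier expansion with coefficients `c`. -/
def hasFourierCoeffs (u : ℝ → ℂ) (c : ℤ → ℂ) : Prop :=
  ∀ x : ℝ, HasSum (fun k : ℤ => c k * Complex.exp (Complex.I * k * x)) (u x)

/-- Membership in the periodic Sobolev space `H^m_p`, expressed via Fourier coefficients. -/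
def inHp (m : ℕ) (c : ℤ → ℂ) : Prop :=
  Summable fun k : ℤ => (|k| : ℝ) ^ (2 * m) * ‖c k‖ ^ 2

/-- `‖∂^m u/∂x^m‖ = (2π Σ_k |k|^{2m}|c_k|²)^{1/2}` for `u` with Fourier coefficients `c`. -/
def sobNorm (m : ℕ) (c : ℤ → ℂ) : ℝ :=
  Real.sqrt (2 * Real.pi * ∑' k : ℤ, (|k| : ℝ) ^ (2 * m) * ‖c k‖ ^ 2)

lemma exp_node_eq_pow (N : ℕ) (m : ℤ) (j : ℕ) :
    Complex.exp (Complex.I * m * node N j) = Complex.exp (Complex.I * m * (π / N)) ^ j := by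
  rw [← Complex.exp_nat_mul]
  congr 1
  simp only [node]
  push_cast
  ring

/-- Orthogonality of the exponentials on the equispaced nodes. -/
lemma sum_exp_node {N : ℕ} (hN : 0 < N) (m : ℤ) :
    (1 / (2 * N : ℂ)) * ∑ j ∈ Finset.range (2 * N), Complex.exp (Complex.I * m * node N j) =
      if (2 * N : ℤ) ∣ m then 1 else 0 := by
  have hNc : (N : ℂ) ≠ 0 := by exact_mod_cast hN.ne'
  have hπ : (π : ℂ) ≠ 0 := by exact_mod_cast Real.pi_ne_zero
  have hone : Complex.exp (Complex.I * m * (π / N)) = 1 ↔ (2 * N : ℤ) ∣ m := by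
    rw [Complex.exp_eq_one_iff]
    refine exists_congr fun n => ?_
    constructor
    · intro h
      have h' : (m : ℂ) = 2 * N * n := by
        field_simp at h
        linear_combination h
      exact_mod_cast h'
    · rintro rfl
      push_cast
      field_simp
  simp only [exp_node_eq_pow]
  split_ifs with h
  · rw [hone.2 h]
    simp
    field_simp
  · have hne : Complex.exp (Complex.I * m * (π / N)) ≠ 1 := fun h' => h (hone.1 h')
    have hpow : Complex.exp (Complex.I * m * (π / N)) ^ (2 * N) = 1 := by
      rw [← Complex.exp_nat_mul, Complex.exp_eq_one_iff]
      refine ⟨m, ?_⟩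
      push_cast
      field_simp
    rw [geom_sum_eq hne, hpow]
    simp

/-- The representative of `l` modulo `2N` in `[-N, N-1]`. -/
def aliasIndex (N : ℕ) (l : ℤ) : ℤ := (l + N) % (2 * N) - N

lemma aliasIndex_mem {N : ℕ} (hN : 0 < N) (l : ℤ) :
    aliasIndex N l ∈ Finset.Icc (-(N : ℤ)) ((N : ℤ) - 1) := by
  have h1 := Int.emod_nonneg (l + N) (b := 2 * N) (by omega)
  have h2 := Int.emod_lt_of_pos (l + N) (b := 2 * N) (by omega)
  simp only [aliasIndex, Finset.mem_Icc]
  omega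

lemma dvd_sub_iff_aliasIndex_eq {N : ℕ} {k : ℤ}
    (hk : k ∈ Finset.Icc (-(N : ℤ)) ((N : ℤ) - 1)) (l : ℤ) :
    (2 * N : ℤ) ∣ l - k ↔ k = aliasIndex N l := by
  simp only [Finset.mem_Icc] at hk
  constructor
  · rintro ⟨q, hq⟩
    have : l + N = (k + N) + 2 * N * q := by linarith
    rw [aliasIndex, this, Int.add_mul_emod_self_left, Int.emod_eq_of_lt (by omega) (by omega)]
    ring
  · rintro rfl
    refine ⟨(l + N) / (2 * N), ?_⟩
    have := Int.mul_ediv_add_emod (l + N) (2 * N)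
    rw [aliasIndex]
    linarith

lemma aliasIndex_eq_self {N : ℕ} {l : ℤ}
    (hl : l ∈ Finset.Icc (-(N : ℤ)) ((N : ℤ) - 1)) : aliasIndex N l = l :=
  ((dvd_sub_iff_aliasIndex_eq hl l).1 (by simp)).symm

lemma abs_aliasIndex_le {N : ℕ} (hN : 0 < N) (l : ℤ) : |aliasIndex N l| ≤ |l| := by
  by_cases hl : l ∈ Finset.Icc (-(N : ℤ)) ((N : ℤ) - 1)
  · rw [aliasIndex_eq_self hl]
  · have h := aliasIndex_mem hN l
    simp only [Finset.mem_Icc] at h hl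
    have h1 : |aliasIndex N l| ≤ N := abs_le.2 ⟨by omega, by omega⟩
    have h2 : (N : ℤ) ≤ |l| := by
      rcases abs_cases l with h | h <;> omega
    exact h1.trans h2

lemma mean_exp_mul_exp {N : ℕ} (hN : 0 < N) {k : ℤ}
    (hk : k ∈ Finset.Icc (-(N : ℤ)) ((N : ℤ) - 1)) (l : ℤ) :
    (1 / (2 * N : ℂ)) * ∑ j ∈ Finset.range (2 * N), Complex.exp (Complex.I * l * node N j) *
        Complex.exp (-(Complex.I * k * node N j)) = if k = aliasIndex N l then 1 else 0 := by
  have h := sum_exp_node hN (l - k)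
  simp only [dvd_sub_iff_aliasIndex_eq hk] at h
  rw [← h]
  congr 1
  refine Finset.sum_congr rfl fun j _ => ?_
  rw [← Complex.exp_add]
  congr 1
  push_cast
  ring

lemma exp_aliasIndex_node {N : ℕ} (hN : 0 < N) (l : ℤ) (j : ℕ) :
    Complex.exp (Complex.I * aliasIndex N l * node N j) =
      Complex.exp (Complex.I * l * node N j) := by
  obtain ⟨q, hq⟩ := (dvd_sub_iff_aliasIndex_eq (aliasIndex_mem hN l) l).2 rfl
  have hNc : (N : ℂ) ≠ 0 := by exact_mod_cast hN.ne'
  have hl : (l : ℂ) = aliasIndex N l + 2 * N * q := by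
    have : l = aliasIndex N l + 2 * N * q := by linarith
    exact_mod_cast this
  rw [Complex.exp_eq_exp_iff_exists_int]
  refine ⟨-(q * j), ?_⟩
  rw [hl, node]
  push_cast
  field_simp
  ring

lemma hasSum_sum_dftCoeff {N : ℕ} (hN : 0 < N) {u : ℝ → ℂ} {c : ℤ → ℂ}
    (hu : hasFourierCoeffs u c) (g : ℤ → ℂ) :
    HasSum (fun l => c l * g (aliasIndex N l))
      (∑ k ∈ Finset.Icc (-(N : ℤ)) ((N : ℤ) - 1), g k * dftCoeff N u k) := by
  have h := hasSum_sum (s := Finset.Icc (-(N : ℤ)) ((N : ℤ) - 1)) fun k _ =>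
    ((hasSum_sum (s := Finset.range (2 * N)) fun j _ =>
      (hu (node N j)).mul_right (Complex.exp (-(Complex.I * k * node N j)))).mul_left
        (1 / (2 * N : ℂ))).mul_left (g k)
  rw [show (fun l => c l * g (aliasIndex N l)) = _ from funext fun l => ?_]
  · exact h
  have h2 : ∀ k ∈ Finset.Icc (-(N : ℤ)) ((N : ℤ) - 1), g k * ((1 / (2 * N : ℂ)) *
      ∑ j ∈ Finset.range (2 * N), c l * Complex.exp (Complex.I * l * node N j) *
        Complex.exp (-(Complex.I * k * node N j))) =
      if k = aliasIndex N l then c l * g k else 0 := by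
    intro k hk
    rw [← mul_one (c l * g k), ← mul_ite_zero, ← mean_exp_mul_exp hN hk l]
    simp only [mul_assoc, ← Finset.mul_sum]
    ring
  exact ((Finset.sum_congr rfl h2).trans
    (by rw [Finset.sum_ite_eq', if_pos (aliasIndex_mem hN l)])).symm

lemma dftCoeff_sub (N : ℕ) (f g : ℝ → ℂ) (k : ℤ) :
    dftCoeff N (fun x => f x - g x) k = dftCoeff N f k - dftCoeff N g k := by
  simp only [dftCoeff, sub_mul, Finset.sum_sub_distrib, mul_sub]

lemma dftCoeff_trigPoly {N : ℕ} (hN : 0 < N) (a : ℤ → ℂ) {k : ℤ}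
    (hk : k ∈ Finset.Icc (-(N : ℤ)) ((N : ℤ) - 1)) : dftCoeff N (trigPoly N a) k = a k := by
  have h : ∀ l ∈ Finset.Icc (-(N : ℤ)) ((N : ℤ) - 1), a l * ((1 / (2 * N : ℂ)) *
      ∑ j ∈ Finset.range (2 * N), Complex.exp (Complex.I * l * node N j) *
        Complex.exp (-(Complex.I * k * node N j))) = if k = l then a l else 0 := by
    intro l hl
    rw [mean_exp_mul_exp hN hk, aliasIndex_eq_self hl, mul_ite, mul_one, mul_zero]
  have h2 := Finset.sum_congr rfl h
  rw [Finset.sum_ite_eq, if_pos hk] at h2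
  rw [← h2, dftCoeff]
  simp only [trigPoly, Finset.sum_mul, Finset.mul_sum]
  rw [Finset.sum_comm]
  refine Finset.sum_congr rfl fun l _ => Finset.sum_congr rfl fun j _ => ?_
  ring

lemma mean_mul_conj_trigPoly (N : ℕ) (f : ℝ → ℂ) (a : ℤ → ℂ) :
    (1 / (2 * N : ℂ)) * ∑ j ∈ Finset.range (2 * N),
        f (node N j) * (starRingEnd ℂ) (trigPoly N a (node N j)) =
      ∑ k ∈ Finset.Icc (-(N : ℤ)) ((N : ℤ) - 1), dftCoeff N f k * (starRingEnd ℂ) (a k) := by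
  simp only [trigPoly, dftCoeff, map_sum, map_mul, ← Complex.exp_conj, Complex.conj_I,
    Complex.conj_ofReal, Finset.mul_sum, Finset.sum_mul, map_intCast]
  rw [Finset.sum_comm]
  refine Finset.sum_congr rfl fun k _ => Finset.sum_congr rfl fun j _ => ?_
  rw [show -Complex.I * (k : ℂ) * (node N j : ℂ) = -(Complex.I * k * node N j) by ring]
  ring

/-- The discrete mean-square norm of a trigonometric polynomial (Parseval). -/
lemma mean_norm_sq_trigPoly {N : ℕ} (hN : 0 < N) (a : ℤ → ℂ) :
    (1 / (2 * N : ℝ)) * ∑ j ∈ Finset.range (2 * N), ‖trigPoly N a (node N j)‖ ^ 2 =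
      ∑ k ∈ Finset.Icc (-(N : ℤ)) ((N : ℤ) - 1), ‖a k‖ ^ 2 := by
  have h := mean_mul_conj_trigPoly N (trigPoly N a) a
  have h2 : ∀ k ∈ Finset.Icc (-(N : ℤ)) ((N : ℤ) - 1),
      dftCoeff N (trigPoly N a) k * (starRingEnd ℂ) (a k) = a k * (starRingEnd ℂ) (a k) :=
    fun k hk => by rw [dftCoeff_trigPoly hN a hk]
  rw [Finset.sum_congr rfl h2] at h
  simp only [Complex.mul_conj'] at h
  apply Complex.ofReal_injective
  push_cast
  exact h

/-- Bessel's inequality on the nodes. -/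
lemma sum_norm_sq_dftCoeff_le {N : ℕ} (hN : 0 < N) (f : ℝ → ℂ) :
    ∑ k ∈ Finset.Icc (-(N : ℤ)) ((N : ℤ) - 1), ‖dftCoeff N f k‖ ^ 2 ≤
      (1 / (2 * N : ℝ)) * ∑ j ∈ Finset.range (2 * N), ‖f (node N j)‖ ^ 2 := by
  have h1 := mean_norm_sq_trigPoly hN (dftCoeff N f)
  have h2 := congrArg Complex.re (mean_mul_conj_trigPoly N f (dftCoeff N f))
  simp only [Complex.mul_conj'] at h2
  have h3 : (1 / (2 * N : ℂ)) = ((1 / (2 * N : ℝ) : ℝ) : ℂ) := by push_cast; rfl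
  rw [h3, Complex.re_ofReal_mul, Complex.re_sum] at h2
  have h4 : (∑ k ∈ Finset.Icc (-(N : ℤ)) ((N : ℤ) - 1), (‖dftCoeff N f k‖ : ℂ) ^ 2).re =
      ∑ k ∈ Finset.Icc (-(N : ℤ)) ((N : ℤ) - 1), ‖dftCoeff N f k‖ ^ 2 := by
    rw [← Complex.ofReal_re (∑ k ∈ Finset.Icc (-(N : ℤ)) ((N : ℤ) - 1), ‖dftCoeff N f k‖ ^ 2)]
    push_cast
    rfl
  rw [h4] at h2
  have h5 : ∑ j ∈ Finset.range (2 * N), 2 * (f (node N j) *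
        (starRingEnd ℂ) (trigPoly N (dftCoeff N f) (node N j))).re ≤
      ∑ j ∈ Finset.range (2 * N), (‖f (node N j)‖ ^ 2 +
        ‖trigPoly N (dftCoeff N f) (node N j)‖ ^ 2) := by
    refine Finset.sum_le_sum fun j _ => ?_
    have h6 := Complex.re_le_norm (f (node N j) *
        (starRingEnd ℂ) (trigPoly N (dftCoeff N f) (node N j)))
    rw [norm_mul, Complex.norm_conj] at h6
    nlinarith [two_mul_le_add_sq ‖f (node N j)‖ ‖trigPoly N (dftCoeff N f) (node N j)‖]
  rw [← Finset.mul_sum, Finset.sum_add_distrib] at h5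
  have h7 := mul_le_mul_of_nonneg_left h5 (a := 1 / (2 * N : ℝ)) (by positivity)
  rw [mul_add] at h7
  linarith

lemma memSN.eq_trigPoly_dftCoeff {N : ℕ} (hN : 0 < N) {v : ℝ → ℂ} (hv : memSN N v) :
    v = trigPoly N (dftCoeff N v) := by
  obtain ⟨a, rfl⟩ := hv
  funext x
  exact Finset.sum_congr rfl fun k hk => by rw [dftCoeff_trigPoly hN a hk]

lemma deriv_trigPoly (N : ℕ) (a : ℤ → ℂ) :
    deriv (trigPoly N a) = trigPoly N (fun k => Complex.I * k * a k) := by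
  funext x
  refine HasDerivAt.deriv (HasDerivAt.fun_sum fun k _ => ?_)
  have h : HasDerivAt (fun x : ℝ => Complex.I * k * (x : ℂ)) (Complex.I * k) x := by
    simpa using (Complex.ofRealCLM.hasDerivAt (x := x)).const_mul (Complex.I * k)
  have h2 := h.cexp.const_mul (a k)
  rwa [show a k * (Complex.exp (Complex.I * k * x) * (Complex.I * k)) =
    Complex.I * k * a k * Complex.exp (Complex.I * k * x) by ring] at h2

lemma iteratedDeriv_two_trigPoly (N : ℕ) (a : ℤ → ℂ) :
    iteratedDeriv 2 (trigPoly N a) = trigPoly N (fun k => -(k : ℂ) ^ 2 * a k) := by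
  rw [iteratedDeriv_succ, iteratedDeriv_one, deriv_trigPoly, deriv_trigPoly]
  congr 1
  funext k
  linear_combination (k : ℂ) ^ 2 * a k * Complex.I_sq

lemma norm_exp_I_mul (k : ℤ) (x : ℝ) : ‖Complex.exp (Complex.I * k * x)‖ = 1 := by
  rw [show Complex.I * k * x = ((k * x : ℝ) : ℂ) * Complex.I by push_cast; ring,
    Complex.norm_exp_ofReal_mul_I]

lemma norm_trigPoly_le (N : ℕ) (a : ℤ → ℂ) (x : ℝ) :
    ‖trigPoly N a x‖ ≤ ∑ k ∈ Finset.Icc (-(N : ℤ)) ((N : ℤ) - 1), ‖a k‖ := by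
  refine (norm_sum_le _ _).trans (Finset.sum_le_sum fun k _ => ?_)
  rw [norm_mul, norm_exp_I_mul, mul_one]

lemma trigPoly_add (N : ℕ) (a b : ℤ → ℂ) (x : ℝ) :
    trigPoly N (fun k => a k + b k) x = trigPoly N a x + trigPoly N b x := by
  simp only [trigPoly, add_mul, Finset.sum_add_distrib]

lemma trigPoly_const_mul (N : ℕ) (r : ℂ) (a : ℤ → ℂ) (x : ℝ) :
    trigPoly N (fun k => r * a k) x = r * trigPoly N a x := by
  simp only [trigPoly, Finset.mul_sum, mul_assoc]

lemma summable_ite_zero {ι : Type*} {f : ι → ℝ} (hf : ∀ l, 0 ≤ f l) (hs : Summable f)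
    (p : ι → Prop) [DecidablePred p] : Summable fun l => if p l then 0 else f l :=
  Summable.of_nonneg_of_le (fun l => by split_ifs; exacts [le_rfl, hf l])
    (fun l => by split_ifs; exacts [hf l, le_rfl]) hs

lemma summable_inv_sq_int : Summable fun l : ℤ => ((l : ℝ) ^ 2)⁻¹ := by
  simpa [one_div] using Real.summable_one_div_int_pow (p := 2).2 one_lt_two

lemma tsum_nat_tail_inv_sq_le {N : ℕ} (hN : 0 < N) :
    (∑' n : ℕ, if n < N then (0 : ℝ) else ((n : ℝ) ^ 2)⁻¹) ≤ 2 / N := by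
  refine Real.tsum_le_of_sum_range_le (fun n => by positivity) fun n => ?_
  have h := sum_Ioo_inv_sq_le (α := ℝ) (N - 1) n
  rw [Nat.cast_sub hN, Nat.cast_one, sub_add_cancel] at h
  refine le_trans (le_of_eq ?_) h
  rw [← Finset.sum_filter_add_sum_filter_not (Finset.range n) (fun i => i < N),
    Finset.sum_congr rfl fun i hi => if_pos (Finset.mem_filter.1 hi).2, Finset.sum_const_zero,
    zero_add, Finset.sum_congr rfl fun i hi => if_neg (Finset.mem_filter.1 hi).2]
  refine Finset.sum_congr ?_ fun _ _ => rfl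
  ext i
  simp only [Finset.mem_filter, Finset.mem_range, Finset.mem_Ioo]
  omega

lemma tsum_int_tail_inv_sq_le {N : ℕ} (hN : 0 < N) :
    (∑' l : ℤ, if l ∈ Finset.Icc (-(N : ℤ)) ((N : ℤ) - 1) then (0 : ℝ) else ((l : ℝ) ^ 2)⁻¹)
      ≤ 4 / N := by
  have hs : Summable fun l : ℤ =>
      if l ∈ Finset.Icc (-(N : ℤ)) ((N : ℤ) - 1) then (0 : ℝ) else ((l : ℝ) ^ 2)⁻¹ :=
    summable_ite_zero (fun l => by positivity) summable_inv_sq_int _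
  have hn : Summable fun n : ℕ => if n < N then (0 : ℝ) else ((n : ℝ) ^ 2)⁻¹ :=
    summable_ite_zero (fun n => by positivity) (Real.summable_nat_pow_inv.2 one_lt_two) _
  obtain ⟨f, hf⟩ : ∃ f : ℤ → ℝ, f = fun l : ℤ =>
    if l ∈ Finset.Icc (-(N : ℤ)) ((N : ℤ) - 1) then (0 : ℝ) else ((l : ℝ) ^ 2)⁻¹ := ⟨_, rfl⟩
  rw [← hf] at hs ⊢
  have h1 : Summable fun n : ℕ => f n := hs.comp_injective Nat.cast_injective
  have h2 : Summable fun n : ℕ => f (-(n + 1 : ℤ)) :=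
    hs.comp_injective (i := fun n : ℕ => -(n + 1 : ℤ)) fun a b h => by simpa using h
  have c1 : ∀ n : ℕ, f n ≤ if n < N then (0 : ℝ) else ((n : ℝ) ^ 2)⁻¹ := fun n => by
    simp only [hf, Finset.mem_Icc]
    by_cases h : n < N
    · rw [if_pos h, if_pos ⟨by omega, by omega⟩]
    · rw [if_neg h, if_neg (by omega), Int.cast_natCast]
  have c2 : ∀ n : ℕ, f (-(n + 1 : ℤ)) ≤ if n < N then (0 : ℝ) else ((n : ℝ) ^ 2)⁻¹ := fun n => by
    simp only [hf, Finset.mem_Icc]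
    by_cases h : n < N
    · rw [if_pos h, if_pos ⟨by omega, by omega⟩]
    · rw [if_neg h, if_neg (by omega)]
      have : (0 : ℝ) < n := by exact_mod_cast (by omega : 0 < n)
      push_cast
      rw [neg_sq]
      gcongr
      linarith
  have b1 := (h1.tsum_le_tsum c1 hn).trans (tsum_nat_tail_inv_sq_le hN)
  have b2 := (h2.tsum_le_tsum c2 hn).trans (tsum_nat_tail_inv_sq_le hN)
  rw [tsum_of_nat_of_neg_add_one h1 h2]
  calc _ ≤ (2 : ℝ) / N + 2 / N := add_le_add b1 b2
    _ = 4 / N := by ring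

lemma sq_mul_le_weighted (l : ℤ) {r t : ℝ} (ht : 0 < t) :
    (l : ℝ) ^ 2 * r ≤ (t * (|(l : ℝ)| ^ 6 * r ^ 2) + t⁻¹ * ((l : ℝ) ^ 2)⁻¹) / 2 := by
  rcases eq_or_ne l 0 with rfl | hl
  · simp
  have hl' : |(l : ℝ)| ≠ 0 := abs_ne_zero.2 (by exact_mod_cast hl)
  rw [← sq_abs (l : ℝ)]
  have h := mul_nonneg ht.le (sq_nonneg (|(l : ℝ)| ^ 3 * r - t⁻¹ * |(l : ℝ)|⁻¹))
  have e : t * (|(l : ℝ)| ^ 3 * r - t⁻¹ * |(l : ℝ)|⁻¹) ^ 2 =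
      t * (|(l : ℝ)| ^ 6 * r ^ 2) + t⁻¹ * (|(l : ℝ)| ^ 2)⁻¹ - 2 * (|(l : ℝ)| ^ 2 * r) := by
    field_simp
    ring
  linarith

lemma summable_sq_mul_norm {c : ℤ → ℂ}
    (hc : Summable fun l : ℤ => |(l : ℝ)| ^ 6 * ‖c l‖ ^ 2) :
    Summable fun l : ℤ => (l : ℝ) ^ 2 * ‖c l‖ :=
  Summable.of_nonneg_of_le (fun l => by positivity) (fun l => sq_mul_le_weighted l one_pos)
    (((hc.mul_left 1).add (summable_inv_sq_int.mul_left 1⁻¹)).div_const 2)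

lemma tsum_sq_mul_norm_le {c : ℤ → ℂ}
    (hc : Summable fun l : ℤ => |(l : ℝ)| ^ 6 * ‖c l‖ ^ 2) {Q : ℝ}
    (hQ : ∑' l : ℤ, |(l : ℝ)| ^ 6 * ‖c l‖ ^ 2 ≤ Q) :
    ∑' l : ℤ, (l : ℝ) ^ 2 * ‖c l‖ ≤ (Q + ∑' l : ℤ, ((l : ℝ) ^ 2)⁻¹) / 2 := by
  have h := (summable_sq_mul_norm hc).tsum_le_tsum (fun l => sq_mul_le_weighted l one_pos)
    (((hc.mul_left 1).add (summable_inv_sq_int.mul_left 1⁻¹)).div_const 2)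
  rw [tsum_div_const, (hc.mul_left 1).tsum_add (summable_inv_sq_int.mul_left 1⁻¹)] at h
  simp only [one_mul, inv_one] at h
  linarith

lemma tsum_tail_sq_mul_norm_le {N : ℕ} (hN : 0 < N) {c : ℤ → ℂ}
    (hc : Summable fun l : ℤ => |(l : ℝ)| ^ 6 * ‖c l‖ ^ 2) {Q : ℝ}
    (hQ : ∑' l : ℤ, |(l : ℝ)| ^ 6 * ‖c l‖ ^ 2 ≤ Q) :
    (∑' l : ℤ, if l ∈ Finset.Icc (-(N : ℤ)) ((N : ℤ) - 1) then 0 else (l : ℝ) ^ 2 * ‖c l‖) ≤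
      (Q + 4) / 2 / √N := by
  have hsN : 0 < √(N : ℝ) := by positivity
  have h0 : Summable fun l : ℤ =>
      if l ∈ Finset.Icc (-(N : ℤ)) ((N : ℤ) - 1) then (0 : ℝ) else ((l : ℝ) ^ 2)⁻¹ :=
    summable_ite_zero (fun l => by positivity) summable_inv_sq_int _
  have h1 : Summable fun l : ℤ =>
      if l ∈ Finset.Icc (-(N : ℤ)) ((N : ℤ) - 1) then 0 else (l : ℝ) ^ 2 * ‖c l‖ :=
    summable_ite_zero (fun l => by positivity) (summable_sq_mul_norm hc) _
  have h2 := (hc.mul_left (√(N : ℝ))⁻¹).add (h0.mul_left (√(N : ℝ)))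
  have h := h1.tsum_le_tsum (fun l => by
    split_ifs with hl
    · rw [mul_zero, add_zero]
      positivity
    · simpa only [inv_inv] using sq_mul_le_weighted l (r := ‖c l‖) (inv_pos.2 hsN))
    (h2.div_const 2)
  rw [tsum_div_const, (hc.mul_left _).tsum_add (h0.mul_left _), tsum_mul_left,
    tsum_mul_left] at h
  refine h.trans ?_
  have h3 : √(N : ℝ) * (4 / N) = 4 * (√(N : ℝ))⁻¹ := by
    nth_rewrite 2 [← Real.mul_self_sqrt (Nat.cast_nonneg N)]
    field_simp
  have h4 := mul_le_mul_of_nonneg_left hQ (inv_pos.2 hsN).le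
  have h5 := mul_le_mul_of_nonneg_left (tsum_int_tail_inv_sq_le hN) hsN.le
  rw [h3] at h5
  calc _ ≤ ((√(N : ℝ))⁻¹ * Q + 4 * (√(N : ℝ))⁻¹) / 2 := by gcongr
    _ = (Q + 4) / 2 / √N := by ring

lemma hasFourierCoeffs.hasDerivAt {u : ℝ → ℂ} {c : ℤ → ℂ} (hu : hasFourierCoeffs u c)
    (hc : Summable fun l : ℤ => |(l : ℝ)| * ‖c l‖) (x : ℝ) :
    HasDerivAt u (∑' l : ℤ, Complex.I * l * c l * Complex.exp (Complex.I * l * x)) x := by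
  have hueq : u = fun x : ℝ => ∑' l : ℤ, c l * Complex.exp (Complex.I * l * x) :=
    funext fun x => (hu x).tsum_eq.symm
  rw [hueq]
  refine hasDerivAt_tsum (g := fun (l : ℤ) (x : ℝ) => c l * Complex.exp (Complex.I * l * x))
    (g' := fun (l : ℤ) (x : ℝ) => Complex.I * l * c l * Complex.exp (Complex.I * l * x))
    (y₀ := (0 : ℝ)) hc (fun l y => ?_) (fun l y => ?_) (hu 0).summable x
  · have h : HasDerivAt (fun x : ℝ => Complex.I * l * (x : ℂ)) (Complex.I * l) y := by
      simpa using (Complex.ofRealCLM.hasDerivAt (x := y)).const_mul (Complex.I * l)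
    have h2 := h.cexp.const_mul (c l)
    rwa [show c l * (Complex.exp (Complex.I * l * y) * (Complex.I * l)) =
      Complex.I * l * c l * Complex.exp (Complex.I * l * y) by ring] at h2
  · rw [norm_mul, norm_exp_I_mul, mul_one, norm_mul, norm_mul, Complex.norm_I, one_mul,
      Complex.norm_intCast]

lemma hasFourierCoeffs.deriv {u : ℝ → ℂ} {c : ℤ → ℂ} (hu : hasFourierCoeffs u c)
    (hc : Summable fun l : ℤ => |(l : ℝ)| * ‖c l‖) :
    hasFourierCoeffs (deriv u) (fun l => Complex.I * l * c l) := by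
  intro x
  rw [(hu.hasDerivAt hc x).deriv]
  refine Summable.hasSum (Summable.of_norm (hc.congr fun l => ?_))
  rw [norm_mul, norm_exp_I_mul, mul_one, norm_mul, norm_mul, Complex.norm_I, one_mul,
    Complex.norm_intCast]

lemma deriv_ofReal_comp_of_differentiable {f : ℝ → ℝ}
    (hf : Differentiable ℝ fun x => (f x : ℂ)) :
    deriv (fun x => (f x : ℂ)) = fun x => ((deriv f x : ℝ) : ℂ) := by
  funext x
  have h : DifferentiableAt ℝ f x :=
    (Complex.reCLM.differentiableAt.comp x (hf x) :)
  exact h.hasDerivAt.ofReal_comp.deriv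

lemma abs_int_le_sq (l : ℤ) : |(l : ℝ)| ≤ (l : ℝ) ^ 2 := by
  have h : |l| ≤ l ^ 2 := by
    rw [← sq_abs]
    exact Int.le_self_sq _
  exact_mod_cast h

/-- Fourier expansions of the first two derivatives of a real function. -/
lemma hasFourierCoeffs_derivs {f : ℝ → ℝ} {c : ℤ → ℂ}
    (hf : hasFourierCoeffs (fun x => (f x : ℂ)) c)
    (hc : Summable fun l : ℤ => (l : ℝ) ^ 2 * ‖c l‖) :
    hasFourierCoeffs (fun x => ((deriv f x : ℝ) : ℂ)) (fun l => Complex.I * l * c l) ∧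
    hasFourierCoeffs (fun x => ((iteratedDeriv 2 f x : ℝ) : ℂ))
      (fun l => -(l : ℂ) ^ 2 * c l) := by
  have h1 : Summable fun l : ℤ => |(l : ℝ)| * ‖c l‖ :=
    Summable.of_nonneg_of_le (fun l => by positivity)
      (fun l => mul_le_mul_of_nonneg_right (abs_int_le_sq l) (norm_nonneg _)) hc
  have d1 := hf.deriv h1
  rw [deriv_ofReal_comp_of_differentiable
    fun x => (hf.hasDerivAt h1 x).differentiableAt] at d1
  have h2 : Summable fun l : ℤ => |(l : ℝ)| * ‖Complex.I * l * c l‖ := hc.congr fun l => by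
    rw [norm_mul, norm_mul, Complex.norm_I, one_mul, Complex.norm_intCast, ← mul_assoc, ← sq,
      sq_abs]
  have d2 := d1.deriv h2
  rw [deriv_ofReal_comp_of_differentiable
    fun x => (d1.hasDerivAt h2 x).differentiableAt] at d2
  refine ⟨d1, ?_⟩
  rw [iteratedDeriv_succ, iteratedDeriv_one]
  convert d2 using 2 with l
  linear_combination (-(l : ℂ) ^ 2 * c l) * Complex.I_sq

lemma hasFourierCoeffs.norm_le {v : ℝ → ℂ} {g c : ℤ → ℂ}
    (hv : hasFourierCoeffs v (fun l => g l * c l)) (hg : ∀ l, ‖g l‖ ≤ (l : ℝ) ^ 2)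
    (hc : Summable fun l : ℤ => (l : ℝ) ^ 2 * ‖c l‖) (x : ℝ) :
    ‖v x‖ ≤ ∑' l : ℤ, (l : ℝ) ^ 2 * ‖c l‖ :=
  (hv x).norm_le_of_bounded hc.hasSum fun l => by
    rw [norm_mul, norm_exp_I_mul, mul_one, norm_mul]
    gcongr
    exact hg l

lemma norm_aliasIndex_le {N : ℕ} (hN : 0 < N) {g : ℤ → ℂ} (hg : ∀ l, ‖g l‖ ≤ (l : ℝ) ^ 2)
    (l : ℤ) : ‖g (aliasIndex N l)‖ ≤ (l : ℝ) ^ 2 :=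
  (hg _).trans (sq_le_sq.2 (by exact_mod_cast abs_aliasIndex_le hN l))

lemma hasSum_trigPoly_dftCoeff {N : ℕ} (hN : 0 < N) {u : ℝ → ℂ} {c : ℤ → ℂ}
    (hu : hasFourierCoeffs u c) (g : ℤ → ℂ) (x : ℝ) :
    HasSum (fun l => c l * (g (aliasIndex N l) *
        Complex.exp (Complex.I * aliasIndex N l * x)))
      (trigPoly N (fun k => g k * dftCoeff N u k) x) := by
  have h := hasSum_sum_dftCoeff hN hu (fun k => g k * Complex.exp (Complex.I * k * x))
  rwa [show trigPoly N (fun k => g k * dftCoeff N u k) x = _ from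
    Finset.sum_congr rfl fun k _ => mul_right_comm _ _ _]

lemma norm_trigPoly_dftCoeff_le {N : ℕ} (hN : 0 < N) {u : ℝ → ℂ} {g c : ℤ → ℂ}
    (hu : hasFourierCoeffs u c) (hg : ∀ l, ‖g l‖ ≤ (l : ℝ) ^ 2)
    (hc : Summable fun l : ℤ => (l : ℝ) ^ 2 * ‖c l‖) (x : ℝ) :
    ‖trigPoly N (fun k => g k * dftCoeff N u k) x‖ ≤ ∑' l : ℤ, (l : ℝ) ^ 2 * ‖c l‖ :=
  (hasSum_trigPoly_dftCoeff hN hu g x).norm_le_of_bounded hc.hasSum fun l => by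
    rw [norm_mul, norm_mul, norm_exp_I_mul, mul_one, mul_comm]
    gcongr
    exact norm_aliasIndex_le hN hg l

/-- The derivatives of the interpolant approximate those of the function on the nodes. -/
lemma norm_trigPoly_dftCoeff_sub_le {N : ℕ} (hN : 0 < N) {u v : ℝ → ℂ} {g c : ℤ → ℂ}
    (hu : hasFourierCoeffs u c) (hv : hasFourierCoeffs v (fun l => g l * c l))
    (hg : ∀ l, ‖g l‖ ≤ (l : ℝ) ^ 2)
    (hc : Summable fun l : ℤ => (l : ℝ) ^ 2 * ‖c l‖) (j : ℕ) :
    ‖trigPoly N (fun k => g k * dftCoeff N u k) (node N j) - v (node N j)‖ ≤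
      2 * ∑' l : ℤ,
        if l ∈ Finset.Icc (-(N : ℤ)) ((N : ℤ) - 1) then 0 else (l : ℝ) ^ 2 * ‖c l‖ := by
  have h1 : Summable fun l : ℤ =>
      if l ∈ Finset.Icc (-(N : ℤ)) ((N : ℤ) - 1) then 0 else (l : ℝ) ^ 2 * ‖c l‖ :=
    summable_ite_zero (fun l => by positivity) hc _
  refine ((hasSum_trigPoly_dftCoeff hN hu g (node N j)).sub (hv (node N j))).norm_le_of_bounded
    (h1.hasSum.mul_left 2) fun l => ?_
  rw [exp_aliasIndex_node hN]
  split_ifs with hl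
  · rw [aliasIndex_eq_self hl, mul_zero, ← mul_assoc, mul_comm (c l), sub_self, norm_zero]
  · rw [← mul_assoc, mul_comm (c l), ← sub_mul, ← sub_mul, norm_mul, norm_mul, norm_exp_I_mul,
      mul_one, ← mul_assoc]
    gcongr
    linarith [norm_sub_le (g (aliasIndex N l)) (g l), hg l, norm_aliasIndex_le hN hg l]

/-- The consistency and nonlinear error of the collocation scheme at a node. -/
lemma norm_remainder_le {A B C η K K₁ S : ℝ} (hA : 0 < A) {e₁ e₂ w₁ w₂ u₁ u₂ : ℂ}
    (h2 : ‖w₂ - u₂‖ ≤ 2 * η) (h1 : ‖w₁ - u₁‖ ≤ 2 * η) (hu : ‖u₁‖ ≤ K) (hw : ‖w₁‖ ≤ K)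
    (he : ‖e₁‖ ≤ S) (hη : η ≤ K₁) :
    ‖(A * (e₂ + w₂) + B * (e₁ + w₁) + C * (e₁ + w₁) ^ 2 - (A * u₂ + B * u₁ + C * u₁ ^ 2))
        - (A * e₂ + B * e₁)‖ ≤
      |C| * S * ‖e₁‖ + |C| * (2 * K + 2 * K₁) * ‖e₁‖ + (2 * A + 2 * |B| + 4 * K * |C|) * η := by
  have hη0 : 0 ≤ η := by linarith [norm_nonneg (w₁ - u₁)]
  have hK0 : 0 ≤ K := (norm_nonneg _).trans hw
  rw [show (A * (e₂ + w₂) + B * (e₁ + w₁) + C * (e₁ + w₁) ^ 2 - (A * u₂ + B * u₁ + C * u₁ ^ 2))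
        - (A * e₂ + B * e₁) =
      A * (w₂ - u₂) + B * (w₁ - u₁) + C * ((e₁ + (w₁ - u₁)) * (e₁ + (w₁ + u₁))) by ring]
  have hs : ‖e₁ + (w₁ - u₁)‖ ≤ ‖e₁‖ + 2 * η := (norm_add_le _ _).trans (by linarith)
  have hp : ‖e₁ + (w₁ + u₁)‖ ≤ ‖e₁‖ + 2 * K :=
    (norm_add_le _ _).trans (by linarith [norm_add_le w₁ u₁])
  have hq : ‖e₁‖ * (‖e₁‖ + 2 * η) ≤ ‖e₁‖ * (S + 2 * K₁) := by gcongr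
  calc _ ≤ A * (2 * η) + |B| * (2 * η) + |C| * ((‖e₁‖ + 2 * η) * (‖e₁‖ + 2 * K)) := by
        refine (norm_add₃_le).trans ?_
        simp only [norm_mul, Complex.norm_real, Real.norm_eq_abs, abs_of_pos hA]
        gcongr
    _ = A * (2 * η) + |B| * (2 * η) +
        |C| * (‖e₁‖ * (‖e₁‖ + 2 * η) + 2 * K * ‖e₁‖ + 4 * K * η) := by ring
    _ ≤ A * (2 * η) + |B| * (2 * η) +
        |C| * (‖e₁‖ * (S + 2 * K₁) + 2 * K * ‖e₁‖ + 4 * K * η) := by gcongr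
    _ = _ := by ring

/-- Parabolic energy inequality for one Fourier mode. -/
lemma energy_mode_le {A : ℝ} (hA : 0 < A) (B : ℝ) (k : ℤ) (E F : ℂ) :
    (k : ℝ) ^ 2 * (2 * inner ℝ E ((-A * (k : ℂ) ^ 2 + B * (Complex.I * k)) * E + F)) ≤
      -A * ((k : ℝ) ^ 2 * ‖E‖) ^ 2 + 1 / A * ‖F‖ ^ 2 := by
  have h1 : inner ℝ E ((-A * (k : ℂ) ^ 2 + B * (Complex.I * k)) * E) =
      -A * (k : ℝ) ^ 2 * ‖E‖ ^ 2 := by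
    rw [Complex.inner, mul_assoc, Complex.mul_conj',
      show (-A * (k : ℂ) ^ 2 + B * (Complex.I * k)) * (‖E‖ : ℂ) ^ 2 =
        ((-A * (k : ℝ) ^ 2 * ‖E‖ ^ 2 : ℝ) : ℂ) + ((B * k * ‖E‖ ^ 2 : ℝ) : ℂ) * Complex.I by
        push_cast; ring]
    simp only [Complex.add_re, Complex.ofReal_re, Complex.re_ofReal_mul, Complex.I_re, mul_zero,
      add_zero]
  have h2 := real_inner_le_norm E F
  have h3 : 2 * ((k : ℝ) ^ 2 * ‖E‖) * ‖F‖ ≤ A * ((k : ℝ) ^ 2 * ‖E‖) ^ 2 + 1 / A * ‖F‖ ^ 2 := by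
    have h := mul_nonneg hA.le (sq_nonneg ((k : ℝ) ^ 2 * ‖E‖ - 1 / A * ‖F‖))
    have e : A * ((k : ℝ) ^ 2 * ‖E‖ - 1 / A * ‖F‖) ^ 2 = A * ((k : ℝ) ^ 2 * ‖E‖) ^ 2
        + 1 / A * ‖F‖ ^ 2 - 2 * ((k : ℝ) ^ 2 * ‖E‖) * ‖F‖ := by
      field_simp
      ring
    linarith
  rw [inner_add_right, h1]
  have h4 := mul_le_mul_of_nonneg_left h2 (sq_nonneg (k : ℝ))
  nlinarith

lemma sq_sum_abs_mul_norm_le (I : Finset ℤ) (E : ℤ → ℂ) :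
    (∑ k ∈ I, |(k : ℝ)| * ‖E k‖) ^ 2 ≤
      (∑' l : ℤ, ((l : ℝ) ^ 2)⁻¹) * ∑ k ∈ I, ((k : ℝ) ^ 2 * ‖E k‖) ^ 2 := by
  have h := Finset.sum_mul_sq_le_sq_mul_sq I (fun k : ℤ => |(k : ℝ)|⁻¹)
    (fun k => (k : ℝ) ^ 2 * ‖E k‖)
  have e : ∀ k ∈ I, |(k : ℝ)|⁻¹ * ((k : ℝ) ^ 2 * ‖E k‖) = |(k : ℝ)| * ‖E k‖ := by
    intro k _
    rw [← sq_abs]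
    by_cases hk : |(k : ℝ)| = 0
    · simp [hk]
    · field_simp
  rw [Finset.sum_congr rfl e] at h
  refine h.trans (mul_le_mul_of_nonneg_right ?_ (by positivity))
  simp only [inv_pow, sq_abs]
  exact summable_inv_sq_int.sum_le_tsum I fun k _ => by positivity

/-- The energy of the error grows at most exponentially as long as it is small. -/
lemma energy_deriv_le {N : ℕ} (hN : 0 < N) {A α β γ : ℝ} (hA : 0 < A) (B : ℝ)
    (E : ℤ → ℂ) (f : ℝ → ℂ)
    (hf : ∀ j < 2 * N, ‖f (node N j)‖ ≤
      α * (∑ k ∈ Finset.Icc (-(N : ℤ)) ((N : ℤ) - 1), |(k : ℝ)| * ‖E k‖) *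
          ‖trigPoly N (fun k => Complex.I * k * E k) (node N j)‖ +
        β * ‖trigPoly N (fun k => Complex.I * k * E k) (node N j)‖ + γ)
    (hE : 3 * α ^ 2 * (∑' l : ℤ, ((l : ℝ) ^ 2)⁻¹) *
      ∑ k ∈ Finset.Icc (-(N : ℤ)) ((N : ℤ) - 1), (k : ℝ) ^ 2 * ‖E k‖ ^ 2 ≤ A ^ 2) :
    ∑ k ∈ Finset.Icc (-(N : ℤ)) ((N : ℤ) - 1), (k : ℝ) ^ 2 *
        (2 * inner ℝ (E k) ((-A * (k : ℂ) ^ 2 + B * (Complex.I * k)) * E k + dftCoeff N f k)) ≤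
      3 / A * (β ^ 2 * ∑ k ∈ Finset.Icc (-(N : ℤ)) ((N : ℤ) - 1), (k : ℝ) ^ 2 * ‖E k‖ ^ 2
        + γ ^ 2) := by
  have hNr : (0 : ℝ) < N := by exact_mod_cast hN
  set I := Finset.Icc (-(N : ℤ)) ((N : ℤ) - 1) with hI
  set y := ∑ k ∈ I, (k : ℝ) ^ 2 * ‖E k‖ ^ 2 with hy
  set z := ∑ k ∈ I, ((k : ℝ) ^ 2 * ‖E k‖) ^ 2 with hz
  set S := ∑ k ∈ I, |(k : ℝ)| * ‖E k‖ with hS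
  set Z := ∑' l : ℤ, ((l : ℝ) ^ 2)⁻¹ with hZ
  set e := trigPoly N (fun k => Complex.I * k * E k) with he
  have hy0 : 0 ≤ y := by positivity
  have hz0 : 0 ≤ z := by positivity
  have hSz : S ^ 2 ≤ Z * z := sq_sum_abs_mul_norm_le I E
  have hey : 1 / (2 * N : ℝ) * ∑ j ∈ Finset.range (2 * N), ‖e (node N j)‖ ^ 2 = y := by
    rw [he, mean_norm_sq_trigPoly hN]
    refine Finset.sum_congr rfl fun k _ => ?_
    rw [norm_mul, norm_mul, Complex.norm_I, one_mul, Complex.norm_intCast, mul_pow, sq_abs]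
  have hF : ∑ k ∈ I, ‖dftCoeff N f k‖ ^ 2 ≤ 3 * ((α ^ 2 * S ^ 2 + β ^ 2) * y + γ ^ 2) := by
    refine (sum_norm_sq_dftCoeff_le hN f).trans ?_
    have h : ∑ j ∈ Finset.range (2 * N), ‖f (node N j)‖ ^ 2 ≤ ∑ j ∈ Finset.range (2 * N),
        (3 * (α ^ 2 * S ^ 2 + β ^ 2) * ‖e (node N j)‖ ^ 2 + 3 * γ ^ 2) := by
      refine Finset.sum_le_sum fun j hj => ?_
      have h := pow_le_pow_left₀ (norm_nonneg _) (hf j (Finset.mem_range.1 hj)) 2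
      set a := α * S * ‖e (node N j)‖
      set b := β * ‖e (node N j)‖
      have hab : 3 * (α ^ 2 * S ^ 2 + β ^ 2) * ‖e (node N j)‖ ^ 2 + 3 * γ ^ 2 =
        3 * (a ^ 2 + b ^ 2 + γ ^ 2) := by ring
      rw [hab]
      nlinarith [sq_nonneg (a - b), sq_nonneg (a - γ), sq_nonneg (b - γ)]
    have h2 := mul_le_mul_of_nonneg_left h (a := 1 / (2 * N : ℝ)) (by positivity)
    refine h2.trans (le_of_eq ?_)
    rw [Finset.sum_add_distrib, ← Finset.mul_sum, ← hey, Finset.sum_const, Finset.card_range]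
    simp only [nsmul_eq_mul]
    push_cast
    field_simp
  have h1 := Finset.sum_le_sum fun k (_ : k ∈ I) =>
    energy_mode_le hA B k (E k) (dftCoeff N f k)
  rw [Finset.sum_add_distrib, ← Finset.mul_sum, ← Finset.mul_sum] at h1
  refine h1.trans ?_
  have h2 : 3 * (α ^ 2 * S ^ 2) * y ≤ A ^ 2 * z := by
    calc 3 * (α ^ 2 * S ^ 2) * y ≤ 3 * (α ^ 2 * (Z * z)) * y := by gcongr
      _ = 3 * α ^ 2 * Z * y * z := by ring
      _ ≤ A ^ 2 * z := by gcongr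
  calc -A * z + 1 / A * ∑ k ∈ I, ‖dftCoeff N f k‖ ^ 2
      ≤ -A * z + 1 / A * (A ^ 2 * z + 3 * (β ^ 2 * y + γ ^ 2)) := by
        gcongr
        linarith
    _ = 3 / A * (β ^ 2 * y + γ ^ 2) := by
        field_simp
        ring

lemma sum_abs_mul_norm_le (N : ℕ) (E : ℤ → ℂ) :
    ∑ k ∈ Finset.Icc (-(N : ℤ)) ((N : ℤ) - 1), |(k : ℝ)| * ‖E k‖ ≤
      √(2 * N * ∑ k ∈ Finset.Icc (-(N : ℤ)) ((N : ℤ) - 1), (k : ℝ) ^ 2 * ‖E k‖ ^ 2) := by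
  refine Real.le_sqrt_of_sq_le (sq_sum_le_card_mul_sum_sq.trans (le_of_eq ?_))
  rw [Int.card_Icc, show ((N : ℤ) - 1 + 1 - -(N : ℤ)).toNat = 2 * N by omega]
  simp only [mul_pow, sq_abs]
  push_cast
  rfl

lemma HasDerivAt.dftCoeff {N : ℕ} {v : ℝ → ℝ → ℂ} {v' : ℝ → ℂ} {τ : ℝ}
    (h : ∀ j < 2 * N, HasDerivAt (fun σ => v σ (node N j)) (v' (node N j)) τ) (k : ℤ) :
    HasDerivAt (fun σ => _root_.dftCoeff N (v σ) k) (_root_.dftCoeff N v' k) τ :=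
  (HasDerivAt.fun_sum fun j hj => (h j (Finset.mem_range.1 hj)).mul_const _).const_mul _

lemma dftCoeff_congr {N : ℕ} {f g : ℝ → ℂ} (h : ∀ j < 2 * N, f (node N j) = g (node N j))
    (k : ℤ) : dftCoeff N f k = dftCoeff N g k := by
  simp only [dftCoeff]
  congr 1
  exact Finset.sum_congr rfl fun j hj => by rw [h j (Finset.mem_range.1 hj)]

/-- Grönwall-type barrier: a differential inequality valid below a threshold keeps the solution
below the threshold when the forcing is small. -/
lemma le_exp_of_deriv_le_below {y y' : ℝ → ℝ} {T κ L δ : ℝ} (hκ : 0 ≤ κ) (hL : 0 < L)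
    (hy : ∀ τ ∈ Set.Icc 0 T, HasDerivAt y (y' τ) τ) (h0 : y 0 = 0)
    (hδ : L * Real.exp ((κ + 1) * T) ≤ δ)
    (hb : ∀ τ ∈ Set.Icc 0 T, y τ ≤ δ → y' τ < κ * y τ + L) :
    ∀ τ ∈ Set.Icc 0 T, y τ ≤ L * Real.exp ((κ + 1) * T) := by
  have hmono : ∀ τ ∈ Set.Icc 0 T, L * Real.exp ((κ + 1) * τ) ≤ L * Real.exp ((κ + 1) * T) := by
    intro τ hτ
    gcongr
    exact hτ.2
  have hB : ∀ τ, HasDerivAt (fun t => L * Real.exp ((κ + 1) * t))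
      ((κ + 1) * (L * Real.exp ((κ + 1) * τ))) τ := by
    intro τ
    have h := (((hasDerivAt_id τ).const_mul (κ + 1)).exp).const_mul L
    simp only [id, mul_one] at h
    rwa [show (κ + 1) * (L * Real.exp ((κ + 1) * τ)) =
      L * (Real.exp ((κ + 1) * τ) * (κ + 1)) by ring]
  intro τ hτ
  refine (image_le_of_deriv_right_lt_deriv_boundary'
    (fun t ht => (hy t ht).continuousAt.continuousWithinAt)
    (fun t ht => (hy t (Set.Ico_subset_Icc_self ht)).hasDerivWithinAt) ?_
    (fun t _ => (hB t).continuousAt.continuousWithinAt) (fun t _ => (hB t).hasDerivWithinAt)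
    ?_ hτ).trans (hmono τ hτ)
  · rw [h0]
    positivity
  · intro t ht heq
    have ht' := Set.Ico_subset_Icc_self ht
    have h1 := hb t ht' (heq.le.trans ((hmono t ht').trans hδ))
    have h2 : 1 ≤ Real.exp ((κ + 1) * t) :=
      Real.one_le_exp (mul_nonneg (by linarith) ht'.1)
    rw [heq] at h1
    nlinarith

/-- Spatial form of the error equation: the difference of the right-hand sides of the collocation
and the differential equation is linear in the error up to a controlled remainder. -/
lemma exists_collocation_remainder {N : ℕ} (hN : 0 < N) {A : ℝ} (hA : 0 < A) (B C : ℝ)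
    {f : ℝ → ℝ} {c : ℤ → ℂ} (hf : hasFourierCoeffs (fun x => (f x : ℂ)) c)
    (hc : Summable fun l : ℤ => (l : ℝ) ^ 2 * ‖c l‖) {K K₁ : ℝ} (hK₁ : 0 ≤ K₁)
    (hK : ∑' l : ℤ, (l : ℝ) ^ 2 * ‖c l‖ ≤ K)
    (htail : (∑' l : ℤ, if l ∈ Finset.Icc (-(N : ℤ)) ((N : ℤ) - 1) then 0
      else (l : ℝ) ^ 2 * ‖c l‖) ≤ K₁ / √N)
    {v : ℝ → ℂ} (hv : memSN N v) {E : ℤ → ℂ}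
    (hE : E = dftCoeff N (fun x => v x - (f x : ℂ))) :
    (∃ r : ℝ → ℂ,
      (∀ k ∈ Finset.Icc (-(N : ℤ)) ((N : ℤ) - 1),
        dftCoeff N (fun x => ((A : ℂ) * iteratedDeriv 2 v x + (B : ℂ) * deriv v x
            + (C : ℂ) * (deriv v x) ^ 2)
          - ((A * iteratedDeriv 2 f x + B * deriv f x + C * (deriv f x) ^ 2 : ℝ) : ℂ)) k =
        (-A * (k : ℂ) ^ 2 + B * (Complex.I * k)) * E k + dftCoeff N r k) ∧
      ∀ j < 2 * N, ‖r (node N j)‖ ≤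
        |C| * (∑ k ∈ Finset.Icc (-(N : ℤ)) ((N : ℤ) - 1), |(k : ℝ)| * ‖E k‖) *
            ‖trigPoly N (fun k => Complex.I * k * E k) (node N j)‖ +
          |C| * (2 * K + 2 * K₁) * ‖trigPoly N (fun k => Complex.I * k * E k) (node N j)‖ +
          (2 * A + 2 * |B| + 4 * K * |C|) * K₁ / √N) ∧
    ∀ x, ‖deriv v x‖ ≤
      (∑ k ∈ Finset.Icc (-(N : ℤ)) ((N : ℤ) - 1), |(k : ℝ)| * ‖E k‖) + K := by
  have hN1 : (1 : ℝ) ≤ N := by exact_mod_cast hN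
  obtain ⟨hf1, hf2⟩ := hasFourierCoeffs_derivs hf hc
  set W := dftCoeff N (fun x => (f x : ℂ)) with hW
  have hV : dftCoeff N v = fun k => E k + W k := by
    funext k
    rw [hE, dftCoeff_sub, hW, sub_add_cancel]
  have hvE := hv.eq_trigPoly_dftCoeff hN
  rw [hV] at hvE
  have hv1 : ∀ x, deriv v x = trigPoly N (fun k => Complex.I * k * E k) x +
      trigPoly N (fun k => Complex.I * k * W k) x := by
    intro x
    rw [hvE, deriv_trigPoly, ← trigPoly_add]
    simp only [mul_add]
  have hv2 : ∀ x, iteratedDeriv 2 v x = trigPoly N (fun k => -(k : ℂ) ^ 2 * E k) x +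
      trigPoly N (fun k => -(k : ℂ) ^ 2 * W k) x := by
    intro x
    rw [hvE, iteratedDeriv_two_trigPoly, ← trigPoly_add]
    simp only [mul_add]
  have hg1 : ∀ l : ℤ, ‖Complex.I * l‖ ≤ (l : ℝ) ^ 2 := fun l => by
    rw [norm_mul, Complex.norm_I, one_mul, Complex.norm_intCast]
    exact abs_int_le_sq l
  have hg2 : ∀ l : ℤ, ‖-(l : ℂ) ^ 2‖ ≤ (l : ℝ) ^ 2 := fun l => by
    rw [norm_neg, norm_pow, Complex.norm_intCast, sq_abs]
  have hw1 : ∀ x, ‖trigPoly N (fun k => Complex.I * k * W k) x‖ ≤ K := fun x =>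
    (norm_trigPoly_dftCoeff_le hN hf hg1 hc x).trans hK
  have he1 : ∀ x, ‖trigPoly N (fun k => Complex.I * k * E k) x‖ ≤
      ∑ k ∈ Finset.Icc (-(N : ℤ)) ((N : ℤ) - 1), |(k : ℝ)| * ‖E k‖ := fun x => by
    refine (norm_trigPoly_le N _ x).trans (le_of_eq (Finset.sum_congr rfl fun k _ => ?_))
    rw [norm_mul, norm_mul, Complex.norm_I, one_mul, Complex.norm_intCast]
  refine ⟨?_, fun x => by
    rw [hv1]
    exact (norm_add_le _ _).trans (add_le_add (he1 x) (hw1 x))⟩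
  refine ⟨fun x => (((A : ℂ) * iteratedDeriv 2 v x + (B : ℂ) * deriv v x
        + (C : ℂ) * (deriv v x) ^ 2)
      - ((A * iteratedDeriv 2 f x + B * deriv f x + C * (deriv f x) ^ 2 : ℝ) : ℂ))
      - trigPoly N (fun k => (-A * (k : ℂ) ^ 2 + B * (Complex.I * k)) * E k) x, ?_, ?_⟩
  · intro k hk
    rw [dftCoeff_sub N (fun x => ((A : ℂ) * iteratedDeriv 2 v x + (B : ℂ) * deriv v x
        + (C : ℂ) * (deriv v x) ^ 2)
      - ((A * iteratedDeriv 2 f x + B * deriv f x + C * (deriv f x) ^ 2 : ℝ) : ℂ))]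
    rw [dftCoeff_trigPoly hN _ hk, add_sub_cancel]
  · intro j _
    have hη : K₁ / √(N : ℝ) ≤ K₁ := div_le_self hK₁ (Real.one_le_sqrt.2 hN1)
    have h := norm_remainder_le hA (B := B) (C := C)
      (e₂ := trigPoly N (fun k => -(k : ℂ) ^ 2 * E k) (node N j))
      ((norm_trigPoly_dftCoeff_sub_le hN hf hf2 hg2 hc j).trans
        (mul_le_mul_of_nonneg_left htail zero_le_two))
      ((norm_trigPoly_dftCoeff_sub_le hN hf hf1 hg1 hc j).trans
        (mul_le_mul_of_nonneg_left htail zero_le_two))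
      ((hf1.norm_le hg1 hc (node N j)).trans hK) (hw1 (node N j)) (he1 (node N j)) hη
    rw [← mul_div_assoc] at h
    refine le_trans (le_of_eq ?_) h
    dsimp only
    have hlin : trigPoly N (fun k => (-A * (k : ℂ) ^ 2 + B * (Complex.I * k)) * E k) (node N j) =
        A * trigPoly N (fun k => -(k : ℂ) ^ 2 * E k) (node N j) +
          B * trigPoly N (fun k => Complex.I * k * E k) (node N j) := by
      rw [← trigPoly_const_mul, ← trigPoly_const_mul, ← trigPoly_add]
      congr 1
      funext k
      ring
    rw [hv1, hv2, hlin]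
    push_cast
    rfl

lemma sum_abs_pow_six_le_of_sobNorm_le {s : ℕ} (hs : 1 ≤ s) {c : ℤ → ℂ} {M : ℝ}
    (hc : inHp (s + 2) c) (hM : sobNorm (s + 2) c ≤ M) :
    (Summable fun l : ℤ => |(l : ℝ)| ^ 6 * ‖c l‖ ^ 2) ∧
      ∑' l : ℤ, |(l : ℝ)| ^ 6 * ‖c l‖ ^ 2 ≤ M ^ 2 := by
  have hle : ∀ l : ℤ, |(l : ℝ)| ^ 6 * ‖c l‖ ^ 2 ≤ |(l : ℝ)| ^ (2 * (s + 2)) * ‖c l‖ ^ 2 := by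
    intro l
    refine mul_le_mul_of_nonneg_right ?_ (by positivity)
    rcases eq_or_ne l 0 with rfl | hl
    · simp
    · refine pow_le_pow_right₀ ?_ (by omega)
      exact_mod_cast Int.one_le_abs hl
  have h6 := Summable.of_nonneg_of_le (fun l => by positivity) hle hc
  refine ⟨h6, (h6.tsum_le_tsum hle hc).trans ?_⟩
  have h0 : 0 ≤ ∑' l : ℤ, |(l : ℝ)| ^ (2 * (s + 2)) * ‖c l‖ ^ 2 :=
    tsum_nonneg fun l => by positivity
  have h := (Real.sqrt_le_iff.1 hM).2
  nlinarith [Real.pi_gt_three]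

/-- Threshold condition for the collocation solution. -/
theorem threshold_condition_collocation
    (T : ℝ) (hT : 0 < T) (s : ℕ) (hs : 1 ≤ s)
    (A B C : ℝ) (hA : 0 < A)
    (u ut : ℝ → ℝ → ℝ)
    (hper : ∀ τ ∈ Set.Icc (0:ℝ) T, Function.Periodic (u τ) (2 * Real.pi))
    (hderivt : ∀ x : ℝ, ∀ τ ∈ Set.Icc (0:ℝ) T, HasDerivAt (fun σ => u σ x) (ut τ x) τ)
    (hpde : ∀ τ ∈ Set.Icc (0:ℝ) T, ∀ x : ℝ,
      ut τ x = A * iteratedDeriv 2 (u τ) x + B * deriv (u τ) x + C * (deriv (u τ) x) ^ 2)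
    (c d : ℝ → ℤ → ℂ)
    (hc : ∀ τ ∈ Set.Icc (0:ℝ) T,
      hasFourierCoeffs (fun x => (u τ x : ℂ)) (c τ) ∧ inHp (s + 2) (c τ))
    (hd : ∀ τ ∈ Set.Icc (0:ℝ) T,
      hasFourierCoeffs (fun x => (ut τ x : ℂ)) (d τ) ∧ inHp s (d τ))
    (M1 M2 M3 : ℝ)
    (hM1 : ∀ τ ∈ Set.Icc (0:ℝ) T, sobNorm (s + 1) (c τ) ≤ M1)
    (hM2 : ∀ τ ∈ Set.Icc (0:ℝ) T, sobNorm (s + 2) (c τ) ≤ M2)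
    (hM3 : ∀ τ ∈ Set.Icc (0:ℝ) T, sobNorm s (d τ) ≤ M3)
    (uN : ℕ → ℝ → ℝ → ℂ)
    (huNmem : ∀ N : ℕ, ∀ τ ∈ Set.Icc (0:ℝ) T, memSN N (uN N τ))
    (hcolloc : ∀ N : ℕ, ∀ j < 2 * N, ∀ τ ∈ Set.Icc (0:ℝ) T,
      HasDerivAt (fun σ => uN N σ (node N j))
        ((A : ℂ) * iteratedDeriv 2 (uN N τ) (node N j)
          + (B : ℂ) * deriv (uN N τ) (node N j)
          + (C : ℂ) * (deriv (uN N τ) (node N j)) ^ 2) τ)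
    (hcollocC1 : ∀ N : ℕ, ∀ j < 2 * N,
      ContinuousOn (fun τ => deriv (fun σ => uN N σ (node N j)) τ) (Set.Icc (0:ℝ) T))
    (hinit : ∀ N : ℕ, ∀ j < 2 * N, uN N 0 (node N j) = (u 0 (node N j) : ℂ)) :
    ∃ M : ℝ, ∃ N₀ : ℕ, ∀ N : ℕ, N₀ ≤ N → ∀ τ ∈ Set.Icc (0:ℝ) T,
      supNorm (deriv (uN N τ)) ≤ M := by
  set Z := ∑' l : ℤ, ((l : ℝ) ^ 2)⁻¹ with hZ
  have hZ0 : 0 ≤ Z := tsum_nonneg fun l => by positivity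
  set K := (M2 ^ 2 + Z) / 2 with hK
  set K₁ := (M2 ^ 2 + 4) / 2 with hK₁
  have hK₁0 : 0 ≤ K₁ := by positivity
  set β := |C| * (2 * K + 2 * K₁) with hβ
  set Γ := (2 * A + 2 * |B| + 4 * K * |C|) * K₁ with hΓ
  set κ := 3 / A * β ^ 2 with hκ
  have hκ0 : 0 ≤ κ := by positivity
  set L := 3 / A * Γ ^ 2 + 1 with hL
  have hL0 : 0 < L := by positivity
  set δ := A ^ 2 / (3 * |C| ^ 2 * Z + 1) with hδ
  have hδ0 : 0 < δ := by positivity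
  obtain ⟨n, hn⟩ := exists_nat_ge (L * Real.exp ((κ + 1) * T) / δ)
  refine ⟨√(2 * (L * Real.exp ((κ + 1) * T))) + K, n + 1, fun N hnN => ?_⟩
  have hN : 0 < N := by omega
  have hNr : (0 : ℝ) < N := by exact_mod_cast hN
  have hLN : L / N * Real.exp ((κ + 1) * T) ≤ δ := by
    have h1 : (n : ℝ) ≤ N := by exact_mod_cast (by omega : n ≤ N)
    have h2 := (div_le_iff₀ hδ0).1 (hn.trans h1)
    rw [div_mul_eq_mul_div, div_le_iff₀ hNr]
    linarith
  obtain ⟨E, hE⟩ : ∃ E : ℝ → ℤ → ℂ, ∀ τ, E τ = dftCoeff N (fun x => uN N τ x - (u τ x : ℂ)) :=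
    ⟨_, fun _ => rfl⟩
  have hrem := fun τ (hτ : τ ∈ Set.Icc 0 T) =>
    have h6 := sum_abs_pow_six_le_of_sobNorm_le hs (hc τ hτ).2 (hM2 τ hτ)
    exists_collocation_remainder hN hA B C (hc τ hτ).1 (summable_sq_mul_norm h6.1) hK₁0
      (tsum_sq_mul_norm_le h6.1 h6.2) (tsum_tail_sq_mul_norm_le hN h6.1 h6.2)
      (huNmem N τ hτ) (hE τ)
  obtain ⟨E', hE'⟩ : ∃ E' : ℝ → ℤ → ℂ, ∀ τ, E' τ = dftCoeff N (fun x =>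
      ((A : ℂ) * iteratedDeriv 2 (uN N τ) x + (B : ℂ) * deriv (uN N τ) x
        + (C : ℂ) * (deriv (uN N τ) x) ^ 2)
      - ((A * iteratedDeriv 2 (u τ) x + B * deriv (u τ) x + C * (deriv (u τ) x) ^ 2 : ℝ) : ℂ)) :=
    ⟨_, fun _ => rfl⟩
  have hEderiv : ∀ τ ∈ Set.Icc 0 T, ∀ k, HasDerivAt (fun σ => E σ k) (E' τ k) τ := by
    intro τ hτ k
    simp only [hE, hE']
    refine HasDerivAt.dftCoeff (v := fun σ x => uN N σ x - (u σ x : ℂ)) (fun j hj => ?_) k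
    refine (hcolloc N j hj τ hτ).sub ?_
    rw [← hpde τ hτ]
    exact (hderivt (node N j) τ hτ).ofReal_comp
  have hyderiv : ∀ τ ∈ Set.Icc 0 T, HasDerivAt
      (fun σ => ∑ k ∈ Finset.Icc (-(N : ℤ)) ((N : ℤ) - 1), (k : ℝ) ^ 2 * ‖E σ k‖ ^ 2)
      (∑ k ∈ Finset.Icc (-(N : ℤ)) ((N : ℤ) - 1),
        (k : ℝ) ^ 2 * (2 * inner ℝ (E τ k) (E' τ k))) τ := fun τ hτ =>
    HasDerivAt.fun_sum fun k _ => (hEderiv τ hτ k).norm_sq.const_mul _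
  have hy := le_exp_of_deriv_le_below hκ0 (div_pos hL0 hNr) hyderiv
    (Finset.sum_eq_zero fun k _ => by
      rw [hE, dftCoeff_congr (g := fun _ => 0) fun j hj => by rw [hinit N j hj, sub_self]]
      simp [dftCoeff]) hLN ?_
  · intro τ hτ
    have : Nonempty (Set.Icc (0 : ℝ) (2 * π)) := ⟨⟨0, le_rfl, by positivity⟩⟩
    refine ciSup_le fun x => ((hrem τ hτ).2 x.1).trans ?_
    gcongr
    refine (sum_abs_mul_norm_le N (E τ)).trans (Real.sqrt_le_sqrt ?_)
    calc _ ≤ 2 * (N : ℝ) * (L / N * Real.exp ((κ + 1) * T)) := by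
          gcongr
          exact hy τ hτ
      _ = 2 * (L * Real.exp ((κ + 1) * T)) := by field_simp
  · intro τ hτ hyδ
    obtain ⟨r, hr1, hr2⟩ := (hrem τ hτ).1
    have hsmall : 3 * |C| ^ 2 * Z * ∑ k ∈ Finset.Icc (-(N : ℤ)) ((N : ℤ) - 1),
        (k : ℝ) ^ 2 * ‖E τ k‖ ^ 2 ≤ A ^ 2 := by
      calc _ ≤ 3 * |C| ^ 2 * Z * δ := by gcongr
        _ ≤ (3 * |C| ^ 2 * Z + 1) * δ := by gcongr; linarith
        _ = A ^ 2 := mul_div_cancel₀ _ (by positivity)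
    rw [Finset.sum_congr rfl fun k hk => by rw [hE' τ, hr1 k hk]]
    calc _ ≤ 3 / A * (β ^ 2 * ∑ k ∈ Finset.Icc (-(N : ℤ)) ((N : ℤ) - 1),
          (k : ℝ) ^ 2 * ‖E τ k‖ ^ 2 + (Γ / √N) ^ 2) :=
          energy_deriv_le hN hA B (E τ) r hr2 hsmall
      _ = κ * (∑ k ∈ Finset.Icc (-(N : ℤ)) ((N : ℤ) - 1), (k : ℝ) ^ 2 * ‖E τ k‖ ^ 2) +
          3 / A * Γ ^ 2 / N := by
          rw [div_pow, Real.sq_sqrt hNr.le, hκ]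
          ring
      _ < _ := by
          gcongr
          exact lt_add_one _

end
end

section
/- Sup-norm bound on the derivative of the interpolant of a piecewise-smooth periodic function: Let u₀ : ℝ → ℝ be 2π-periodic, continuous and absolutely continuous on [0,2π], whose derivative u₀' is of bounded variation on [0,2π] (in particular u₀ ∈ H¹_p and u₀' has at most finitely many jump discontinuities). Then there exist constants K and C, independent of N, such that for every integer N ≥ 1, ‖(I_N u₀)'‖_∞ ≤ K N^{3/2} ‖I_N u₀ − u₀‖ + C. -/
open Real MeasureTheory

noncomputable section

lemma two_mul_sin_half_mul_sum_sin (n : ℕ) (y : ℝ) :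
    2 * sin (y / 2) * ∑ k ∈ Finset.range n, sin ((k + 1 : ℝ) * y)
      = cos (y / 2) - cos ((n + 1 / 2 : ℝ) * y) := by
  induction n with
  | zero => simp; ring_nf
  | succ n ih =>
    rw [Finset.sum_range_succ, mul_add, ih]
    have h1 : ((n : ℝ) + 1 / 2) * y = (n + 1) * y - y / 2 := by ring
    have h2 : (((n + 1 : ℕ) : ℝ) + 1 / 2) * y = (n + 1) * y + y / 2 := by push_cast; ring
    rw [h1, h2, cos_sub, cos_add]
    ring

lemma abs_sum_sin_mul_le_one (n : ℕ) (y : ℝ) :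
    |∑ k ∈ Finset.range n, sin ((k + 1 : ℝ) * y)| * |sin (y / 2)| ≤ 1 := by
  have h := two_mul_sin_half_mul_sum_sin n y
  rw [← abs_mul, abs_le]
  constructor <;> nlinarith [neg_one_le_cos (y / 2), cos_le_one (y / 2),
    neg_one_le_cos ((n + 1 / 2 : ℝ) * y), cos_le_one ((n + 1 / 2 : ℝ) * y)]

lemma abs_sin_nat_mul_le (n : ℕ) (y : ℝ) : |sin (n * y)| ≤ n * |sin y| := by
  induction n with
  | zero => simp
  | succ n ih =>
    push_cast
    rw [add_mul, one_mul, sin_add]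
    calc _ ≤ |sin (n * y)| * |cos y| + |cos (n * y)| * |sin y| := by
          rw [← abs_mul, ← abs_mul]; exact abs_add_le _ _
      _ ≤ |sin (n * y)| * 1 + 1 * |sin y| := by
          gcongr <;> exact abs_cos_le_one _
      _ ≤ _ := by linarith

lemma abs_sin_le_two_mul_abs_sin_half (y : ℝ) : |sin y| ≤ 2 * |sin (y / 2)| := by
  have h := abs_sin_nat_mul_le 2 (y / 2)
  push_cast at h
  rwa [mul_div_cancel₀ y two_ne_zero] at h

lemma abs_sum_sin_le (n : ℕ) (y : ℝ) :
    |∑ k ∈ Finset.range n, sin ((k + 1 : ℝ) * y)| ≤ n * (n + 1) * |sin (y / 2)| := by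
  induction n with
  | zero => simp
  | succ n ih =>
    rw [Finset.sum_range_succ]
    have h1 := abs_sin_nat_mul_le (n + 1) y
    have h2 := abs_sin_le_two_mul_abs_sin_half y
    push_cast at h1 ⊢
    have h3 : ((n : ℝ) + 1) * |sin y| ≤ (n + 1) * (2 * |sin (y / 2)|) := by gcongr
    refine (abs_add_le _ _).trans ?_
    linarith

/-- Telescoping majorant for `min (1 / (s (k + 1) (k + 2))) s`. -/
lemma div_le_sub_of_mul_le_one {s S : ℝ} (hs0 : 0 ≤ s) (k : ℕ) (hS0 : 0 ≤ S)
    (h1 : S * s ≤ 1) (h2 : S ≤ ((k : ℝ) + 1) * (k + 2) * s) :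
    S / (((k : ℝ) + 1) * (k + 2)) ≤ 6 / (1 + (k + 1) * s) - 6 / (1 + (k + 2) * s) := by
  set p : ℝ := (k + 1) * s with hp
  have hp0 : 0 ≤ p := by positivity
  have hsp : s ≤ p := by rw [hp]; nlinarith [(Nat.cast_nonneg k : (0:ℝ) ≤ k)]
  have e : (1 : ℝ) + (k + 2) * s = 1 + p + s := by rw [hp]; ring
  rw [e]
  have e2 : 6 / (1 + p) - 6 / (1 + p + s) = 6 * s / ((1 + p) * (1 + p + s)) := by
    field_simp; ring
  rw [e2, div_le_div_iff₀ (by positivity) (by positivity)]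
  rcases le_total p 1 with h | h
  · have : (1 + p) * (1 + p + s) ≤ 6 := by nlinarith
    calc _ ≤ S * 6 := by gcongr
      _ ≤ _ := by linarith
  · have : (1 + p) * (1 + p + s) ≤ 4 * (p * (p + s)) := by nlinarith
    have e3 : p * (p + s) = (((k : ℝ) + 1) * (k + 2)) * s * s := by rw [hp]; ring
    calc _ ≤ S * (4 * (p * (p + s))) := by gcongr
      _ = (S * s) * (4 * (((k : ℝ) + 1) * (k + 2)) * s) := by rw [e3]; ring
      _ ≤ 1 * (4 * (((k : ℝ) + 1) * (k + 2)) * s) := by gcongr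
      _ ≤ _ := by nlinarith [show 0 ≤ (((k : ℝ) + 1) * (k + 2)) * s by positivity]

/-- Summation by parts against the weights `1 / (k + 1)`. -/
lemma sum_div_eq_of_abel (a : ℕ → ℝ) (n : ℕ) :
    ∑ k ∈ Finset.range n, a k / (k + 1) = (∑ k ∈ Finset.range n, a k) / (n + 1)
      + ∑ k ∈ Finset.range n, (∑ i ∈ Finset.range (k + 1), a i) / (((k : ℝ) + 1) * (k + 2)) := by
  induction n with
  | zero => simp
  | succ n ih =>
    rw [Finset.sum_range_succ, ih,
      Finset.sum_range_succ (fun k : ℕ => (∑ i ∈ Finset.range (k + 1), a i) / _),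
      Finset.sum_range_succ a]
    push_cast
    field_simp
    ring

/-- The partial sums of `∑ sin (k y) / k` are uniformly bounded. -/
lemma abs_sum_sin_div_le (n : ℕ) (y : ℝ) :
    |∑ k ∈ Finset.range n, sin ((k + 1 : ℝ) * y) / (k + 1)| ≤ 7 := by
  rw [sum_div_eq_of_abel]
  set s := |sin (y / 2)| with hs
  have hs0 : 0 ≤ s := abs_nonneg _
  have h1 := fun n => abs_sum_sin_mul_le_one n y
  have h2 := fun n => abs_sum_sin_le n y
  rw [← hs] at h1 h2
  have hA : |(∑ k ∈ Finset.range n, sin ((k + 1 : ℝ) * y)) / (n + 1)| ≤ 1 := by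
    rw [abs_div, abs_of_nonneg (by positivity : (0:ℝ) ≤ n + 1), div_le_one (by positivity)]
    have a1 := h1 n
    have a2 := h2 n
    generalize |∑ k ∈ Finset.range n, sin ((k + 1 : ℝ) * y)| = S at a1 a2
    by_contra! hc
    have hn : (0 : ℝ) ≤ n := Nat.cast_nonneg n
    rcases le_total (n * s) 1 with h | h <;> nlinarith
  have hB : |∑ k ∈ Finset.range n, (∑ i ∈ Finset.range (k + 1), sin ((i + 1 : ℝ) * y)) /
      (((k : ℝ) + 1) * (k + 2))| ≤ 6 := by
    refine (Finset.abs_sum_le_sum_abs _ _).trans ?_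
    have : ∀ k ∈ Finset.range n, |(∑ i ∈ Finset.range (k + 1), sin ((i + 1 : ℝ) * y)) /
        (((k : ℝ) + 1) * (k + 2))| ≤ 6 / (1 + ((k : ℝ) + 1) * s)
          - 6 / (1 + (((k + 1 : ℕ) : ℝ) + 1) * s) := by
      intro k _
      have a2 := h2 (k + 1)
      push_cast at a2 ⊢
      rw [abs_div, abs_of_nonneg (by positivity : (0:ℝ) ≤ ((k : ℝ) + 1) * (k + 2))]
      refine (div_le_sub_of_mul_le_one hs0 k (abs_nonneg _) (h1 _)
        (by convert a2 using 2; ring)).trans_eq ?_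
      ring
    refine (Finset.sum_le_sum this).trans ?_
    rw [Finset.sum_range_sub']
    have a : 6 / (1 + (((0 : ℕ) : ℝ) + 1) * s) ≤ 6 := div_le_self (by norm_num) (by simp [hs0])
    have b : 0 ≤ 6 / (1 + (((n : ℕ) : ℝ) + 1) * s) := by positivity
    linarith
  exact (abs_add_le _ _).trans (by linarith)

lemma inv_sin_sq_sub_inv_sq_le {t : ℝ} (h0 : 0 < t) (h1 : t ≤ π / 2) :
    |1 / sin t ^ 2 - 1 / t ^ 2| ≤ 3 := by
  have hst : sin t ≤ t := sin_le h0.le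
  have hs : 2 / π * t ≤ sin t := mul_le_sin h0.le h1
  have hs' : t / 2 ≤ sin t := by
    refine le_trans ?_ hs
    rw [div_mul_eq_mul_div, div_le_div_iff₀ (by norm_num) pi_pos]
    nlinarith [pi_le_four]
  have hsp : 0 < sin t := by linarith
  have hle : 1 / t ^ 2 ≤ 1 / sin t ^ 2 := by gcongr
  rw [abs_of_nonneg (by linarith), div_sub_div _ _ (by positivity) (by positivity),
    div_le_iff₀ (by positivity)]
  have hc := (sin_gt_sub_cube h0).le
  have h3 : (t - sin t) * (t + sin t) ≤ t ^ 3 / 6 * (2 * t) := by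
    gcongr <;> linarith
  have h4 : (t / 2) ^ 2 ≤ sin t ^ 2 := by gcongr
  nlinarith [mul_le_mul_of_nonneg_right h4 (sq_nonneg t), pow_pos h0 4]

lemma sum_Icc_neg_eq_sum_range {M : Type*} [AddCommMonoid M] (f : ℤ → M) (n : ℕ) :
    ∑ k ∈ Finset.Icc (-((n : ℤ))) n, f k
      = f 0 + ∑ k ∈ Finset.range n, (f (k + 1) + f (-(k + 1))) := by
  induction n with
  | zero => simp
  | succ n ih =>
    have h : Finset.Icc (-((n + 1 : ℕ) : ℤ)) ((n + 1 : ℕ) : ℤ)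
        = insert ((n : ℤ) + 1) (insert (-((n : ℤ) + 1)) (Finset.Icc (-(n : ℤ)) n)) := by
      ext k; simp only [Finset.mem_Icc, Finset.mem_insert]; omega
    rw [h, Finset.sum_insert, Finset.sum_insert, ih, Finset.sum_range_succ]
    · abel
    · simp
    · simp only [Finset.mem_insert, Finset.mem_Icc]; omega

/-- The symbol of the inverse of minus the second difference on the nodes. -/
def invSecondDiffSymbol (N : ℕ) (k : ℤ) : ℝ := 1 / (4 * sin (k * π / (2 * N)) ^ 2)

lemma invSecondDiffSymbol_neg (N : ℕ) (k : ℤ) :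
    invSecondDiffSymbol N (-k) = invSecondDiffSymbol N k := by
  simp [invSecondDiffSymbol, neg_mul, neg_div, sin_neg]

lemma abs_sum_symbol_mul_sin_le {N : ℕ} {n : ℕ} (hn : n < N) (y : ℝ) :
    |∑ k ∈ Finset.range n, ((k : ℝ) + 1) * invSecondDiffSymbol N (k + 1) * sin ((k + 1 : ℝ) * y)|
      ≤ 2 * (N : ℝ) ^ 2 := by
  have hN : (0 : ℝ) < N := by exact_mod_cast (Nat.zero_le n).trans_lt hn
  set a : ℕ → ℝ := fun k => ((k : ℝ) + 1) / 4 *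
    (1 / sin (((k : ℝ) + 1) * π / (2 * N)) ^ 2 - 1 / (((k : ℝ) + 1) * π / (2 * N)) ^ 2) *
      sin ((k + 1 : ℝ) * y) with ha
  have hsplit : ∀ k : ℕ, ((k : ℝ) + 1) * invSecondDiffSymbol N (k + 1) * sin ((k + 1 : ℝ) * y)
      = a k + (N : ℝ) ^ 2 / π ^ 2 * (sin ((k + 1 : ℝ) * y) / (k + 1)) := by
    intro k
    simp only [ha, invSecondDiffSymbol]
    push_cast
    field_simp
    ring
  have hak : ∀ k ∈ Finset.range n, |a k| ≤ 3 / 4 * N := by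
    intro k hk
    have hkN : (k : ℝ) + 1 ≤ N := by
      have := Finset.mem_range.1 hk
      exact_mod_cast (by omega : k + 1 ≤ N)
    have h := inv_sin_sq_sub_inv_sq_le (t := ((k : ℝ) + 1) * π / (2 * N)) (by positivity) (by
      rw [div_le_div_iff₀ (by positivity) (by norm_num)]
      nlinarith [pi_pos])
    rw [ha]
    simp only [abs_mul]
    rw [abs_of_nonneg (by positivity : (0:ℝ) ≤ ((k : ℝ) + 1) / 4)]
    calc _ ≤ (N : ℝ) / 4 * 3 * 1 := by
          gcongr
          exact abs_sin_le_one _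
      _ = _ := by ring
  have h1 : |∑ k ∈ Finset.range n, a k| ≤ 3 / 4 * (N : ℝ) ^ 2 := by
    refine (Finset.abs_sum_le_sum_abs _ _).trans ((Finset.sum_le_sum hak).trans ?_)
    have : (n : ℝ) ≤ N := by exact_mod_cast hn.le
    simp only [Finset.sum_const, Finset.card_range, nsmul_eq_mul]
    nlinarith
  have h2 : |(N : ℝ) ^ 2 / π ^ 2 * ∑ k ∈ Finset.range n, sin ((k + 1 : ℝ) * y) / (k + 1)|
      ≤ (N : ℝ) ^ 2 * (7 / 9) := by
    rw [abs_mul, abs_of_nonneg (by positivity), div_mul_eq_mul_div, mul_div_assoc]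
    have := abs_sum_sin_div_le n y
    have h9 : (9 : ℝ) ≤ π ^ 2 := by nlinarith [pi_gt_three]
    gcongr
  simp only [hsplit, Finset.sum_add_distrib, ← Finset.mul_sum]
  exact (abs_add_le _ _).trans (by nlinarith [sq_nonneg (N : ℝ)])

/-- Uniform `O(N²)` bound on the kernel sending second differences to the derivative of the interpolant. -/
lemma norm_sum_symbol_mul_exp_le {N : ℕ} (hN : 1 ≤ N) (y : ℝ) :
    ‖∑ k ∈ Finset.Icc (-(N : ℤ)) ((N : ℤ) - 1), Complex.I * k * (invSecondDiffSymbol N k : ℂ) *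
      Complex.exp (Complex.I * k * y)‖ ≤ 5 * (N : ℝ) ^ 2 := by
  obtain ⟨n, rfl⟩ : ∃ n, N = n + 1 := ⟨N - 1, by omega⟩
  set f : ℤ → ℂ := fun k => Complex.I * k * (invSecondDiffSymbol (n + 1) k : ℂ) *
      Complex.exp (Complex.I * k * y) with hf
  have hset : Finset.Icc (-((n + 1 : ℕ) : ℤ)) (((n + 1 : ℕ) : ℤ) - 1)
      = insert (-((n + 1 : ℕ) : ℤ)) (Finset.Icc (-(n : ℤ)) n) := by
    ext k; simp only [Finset.mem_Icc, Finset.mem_insert]; omega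
  rw [hset, Finset.sum_insert (by simp), sum_Icc_neg_eq_sum_range]
  have hpair : ∀ k : ℕ, f (k + 1) + f (-(k + 1)) =
      ((-2 * (((k : ℝ) + 1) * invSecondDiffSymbol (n + 1) (k + 1) * sin ((k + 1 : ℝ) * y)) : ℝ) : ℂ) := by
    intro k
    simp only [hf, invSecondDiffSymbol_neg]
    push_cast
    rw [Complex.sin]
    rw [show Complex.I * (-((k : ℂ) + 1)) * y = -((k + 1) * y) * Complex.I by ring,
      show Complex.I * ((k : ℂ) + 1) * y = (k + 1) * y * Complex.I by ring]
    ring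
  have h0 : f 0 = 0 := by simp [hf]
  have htop : ‖f (-((n + 1 : ℕ) : ℤ))‖ ≤ ((n + 1 : ℕ) : ℝ) ^ 2 := by
    have e : Complex.I * ((-((n + 1 : ℕ) : ℤ) : ℤ) : ℂ) * y
        = ((-((n + 1 : ℕ) : ℝ) * y : ℝ) : ℂ) * Complex.I := by push_cast; ring
    simp only [hf]
    rw [e, invSecondDiffSymbol_neg, norm_mul, Complex.norm_exp_ofReal_mul_I]
    have e2 : invSecondDiffSymbol (n + 1) ((n + 1 : ℕ) : ℤ) = 1 / 4 := by
      have : (((n + 1 : ℕ) : ℤ) : ℝ) * π / (2 * ((n + 1 : ℕ) : ℝ)) = π / 2 := by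
        push_cast; field_simp
      rw [invSecondDiffSymbol, this, sin_pi_div_two]; norm_num
    rw [e2, norm_mul, norm_mul]
    have e3 : ‖((-((n + 1 : ℕ) : ℤ) : ℤ) : ℂ)‖ = (n : ℝ) + 1 := by
      rw [Complex.norm_intCast]
      push_cast
      rw [abs_neg, abs_of_nonneg (by positivity)]
    rw [e3]
    simp only [Complex.norm_I, Complex.norm_real]
    norm_num
    nlinarith [(Nat.cast_nonneg n : (0:ℝ) ≤ n)]
  change ‖f _ + (f 0 + ∑ k ∈ Finset.range n, (f (k + 1) + f (-(k + 1))))‖ ≤ _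
  simp only [hpair, h0, zero_add]
  rw [← Complex.ofReal_sum, ← Finset.mul_sum]
  refine (norm_add_le_of_le htop le_rfl).trans ?_
  rw [Complex.norm_real, Real.norm_eq_abs, abs_mul]
  have := abs_sum_symbol_mul_sin_le (Nat.lt_succ_self n) y
  norm_num at this ⊢
  linarith

lemma BoundedVariationOn.intervalIntegrable {v : ℝ → ℝ} {a b : ℝ}
    (hv : BoundedVariationOn v (Set.uIcc a b)) : IntervalIntegrable v volume a b := by
  obtain ⟨p, q, hp, hq, rfl⟩ := hv.locallyBoundedVariationOn.exists_monotoneOn_sub_monotoneOn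
  exact hp.intervalIntegrable.sub hq.intervalIntegrable

lemma BoundedVariationOn.sum_abs_sub_le {v : ℝ → ℝ} {s : Set ℝ} (hv : BoundedVariationOn v s)
    {m : ℕ} {x : ℕ → ℝ} (hx : MonotoneOn x (Set.Iic m)) (hs : ∀ i ≤ m, x i ∈ s) :
    ∑ i ∈ Finset.range m, |v (x (i + 1)) - v (x i)| ≤ (eVariationOn v s).toReal := by
  have h := eVariationOn.sum_le_of_monotoneOn_Iic (f := v) hx hs
  have h2 := ENNReal.toReal_mono hv h
  rw [ENNReal.toReal_sum (fun _ _ => edist_ne_top _ _)] at h2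
  simpa [edist_dist, Real.dist_eq] using h2

lemma BoundedVariationOn.abs_integral_le {v : ℝ → ℝ} {a b c d : ℝ}
    (hv : BoundedVariationOn v (Set.Icc a b)) (hc : a ≤ c) (hcd : c ≤ d) (hd : d ≤ b) :
    |∫ t in c..d, v t| ≤ (|v a| + (eVariationOn v (Set.Icc a b)).toReal) * (d - c) := by
  have h := intervalIntegral.norm_integral_le_of_norm_le_const (f := v) (a := c) (b := d)
    (C := |v a| + (eVariationOn v (Set.Icc a b)).toReal) (by
      intro t ht
      rw [Set.uIoc_of_le hcd] at ht
      have := hv.dist_le (x := t) (y := a) ⟨by linarith [ht.1], by linarith [ht.2]⟩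
        ⟨le_rfl, by linarith⟩
      rw [Real.dist_eq] at this
      have h2 := abs_add_le (v a) (v t - v a)
      rw [add_sub_cancel] at h2
      rw [Real.norm_eq_abs]
      linarith)
  rwa [abs_of_nonneg (by linarith : 0 ≤ d - c)] at h

/-- Uniform-grid second differences of a primitive of a function of bounded variation. -/
lemma BoundedVariationOn.sum_abs_integral_sub_le {v : ℝ → ℝ} {a h : ℝ} (hh : 0 ≤ h) (m : ℕ)
    (hv : BoundedVariationOn v (Set.Icc a (a + (m + 1) * h))) :
    ∑ j ∈ Finset.range m, |(∫ t in (a + (j + 1) * h)..(a + (j + 2) * h), v t)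
        - ∫ t in (a + j * h)..(a + (j + 1) * h), v t|
      ≤ (eVariationOn v (Set.Icc a (a + (m + 1) * h))).toReal * h := by
  have hint : ∀ j : ℕ, j ≤ m → IntervalIntegrable (fun t => v (a + j * h + t)) volume 0 h := by
    intro j hj
    have hjm : (j : ℝ) ≤ m := by exact_mod_cast hj
    have h1 : IntervalIntegrable v volume (a + j * h) (a + j * h + h) := by
      refine (hv.mono ?_).intervalIntegrable
      rw [Set.uIcc_of_le (by linarith)]
      exact Set.Icc_subset_Icc (by nlinarith [(Nat.cast_nonneg j : (0:ℝ) ≤ j)]) (by nlinarith)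
    have := h1.comp_add_left (a + j * h)
    simpa using this
  have heq : ∀ j ∈ Finset.range m, |(∫ t in (a + (j + 1) * h)..(a + (j + 2) * h), v t)
        - ∫ t in (a + j * h)..(a + (j + 1) * h), v t|
        ≤ ∫ t in (0:ℝ)..h, |v (a + (j + 1 : ℕ) * h + t) - v (a + j * h + t)| := by
    intro j hj
    have hj := Finset.mem_range.1 hj
    have e1 : ∫ t in (0:ℝ)..h, v (a + (j + 1 : ℕ) * h + t)
        = ∫ t in (a + (j + 1) * h)..(a + (j + 2) * h), v t := by
      rw [intervalIntegral.integral_comp_add_left (fun t => v t)]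
      congr 1 <;> push_cast <;> ring
    have e2 : ∫ t in (0:ℝ)..h, v (a + j * h + t)
        = ∫ t in (a + j * h)..(a + (j + 1) * h), v t := by
      rw [intervalIntegral.integral_comp_add_left (fun t => v t)]
      congr 1 <;> ring
    rw [← e1, ← e2, ← intervalIntegral.integral_sub (hint _ hj) (hint _ hj.le)]
    exact intervalIntegral.abs_integral_le_integral_abs hh
  refine (Finset.sum_le_sum heq).trans ?_
  have hint2 : ∀ j ∈ Finset.range m, IntervalIntegrable
      (fun t => |v (a + (j + 1 : ℕ) * h + t) - v (a + j * h + t)|) volume 0 h := by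
    intro j hj
    have hj := Finset.mem_range.1 hj
    exact ((hint _ hj).sub (hint _ hj.le)).abs
  rw [← intervalIntegral.integral_finsetSum hint2]
  refine (intervalIntegral.integral_mono_on hh
    (by simpa [Finset.sum_fn] using IntervalIntegrable.sum _ hint2)
    (g := fun _ => (eVariationOn v (Set.Icc a (a + (m + 1) * h))).toReal)
    intervalIntegrable_const ?_).trans_eq ?_
  · intro t ht
    have := hv.sum_abs_sub_le (m := m) (x := fun j => a + j * h + t) ?_ ?_
    · simpa [Finset.sum_apply] using this
    · intro i _ j _ hij
      have : (i : ℝ) ≤ j := by exact_mod_cast hij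
      simp only
      gcongr
    · intro i hi
      have : (i : ℝ) ≤ m := by exact_mod_cast hi
      have h0 : (0 : ℝ) ≤ i := Nat.cast_nonneg i
      exact ⟨by nlinarith [ht.1], by nlinarith [ht.2]⟩
  · simp [mul_comm]

lemma node_add_two_mul {N : ℕ} (hN : 1 ≤ N) (j : ℕ) : node N (j + 2 * N) = node N j + 2 * π := by
  have : (N : ℝ) ≠ 0 := by positivity
  simp only [node]
  push_cast
  field_simp

/-- The second differences of `u₀` at the nodes have `ℓ¹` norm `O(1 / N)`. -/
lemma sum_abs_second_diff_le
    (u₀ : ℝ → ℝ) (hper : Function.Periodic u₀ (2 * Real.pi))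
    (v : ℝ → ℝ) (hBV : BoundedVariationOn v (Set.Icc (0:ℝ) (2 * Real.pi)))
    (hAC : ∀ x ∈ Set.Icc (0:ℝ) (2 * Real.pi), u₀ x = u₀ 0 + ∫ t in (0:ℝ)..x, v t)
    {N : ℕ} (hN : 1 ≤ N) :
    ∑ j ∈ Finset.range (2 * N), |u₀ (node N (j + 2)) - 2 * u₀ (node N (j + 1)) + u₀ (node N j)|
      ≤ (2 * |v 0| + 3 * (eVariationOn v (Set.Icc (0:ℝ) (2 * Real.pi))).toReal) * (π / N) := by
  set V := (eVariationOn v (Set.Icc (0:ℝ) (2 * Real.pi))).toReal with hV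
  have hN0 : (0 : ℝ) < N := by exact_mod_cast hN
  have hpi := pi_pos
  have hdiff : ∀ x y : ℝ, 0 ≤ x → x ≤ y → y ≤ 2 * π → u₀ y - u₀ x = ∫ t in x..y, v t := by
    intro x y hx hxy hy
    have hi : ∀ z, 0 ≤ z → z ≤ 2 * π → IntervalIntegrable v volume 0 z := by
      intro z hz hz'
      refine (hBV.mono ?_).intervalIntegrable
      rw [Set.uIcc_of_le hz]
      exact Set.Icc_subset_Icc_right hz'
    rw [hAC y ⟨hx.trans hxy, hy⟩, hAC x ⟨hx, hxy.trans hy⟩,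
      ← intervalIntegral.integral_interval_sub_left (hi y (hx.trans hxy) hy)
        (hi x hx (hxy.trans hy))]
    ring
  have hstep : ∀ j : ℕ, j + 1 ≤ 2 * N → u₀ (node N (j + 1)) - u₀ (node N j)
      = ∫ t in (j * (π / N))..((j + 1) * (π / N)), v t := by
    intro j hj
    have hjN : (j : ℝ) + 1 ≤ 2 * N := by exact_mod_cast hj
    rw [hdiff]
    · simp only [node]; push_cast; congr 1 <;> ring
    · simp only [node]; positivity
    · simp only [node]; gcongr; simp
    · simp only [node]; push_cast
      rw [div_le_iff₀ hN0]; nlinarith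
  have hbound : ∀ j : ℕ, j + 1 ≤ 2 * N → |u₀ (node N (j + 1)) - u₀ (node N j)|
      ≤ (|v 0| + V) * (π / N) := by
    intro j hj
    have hjN : (j : ℝ) + 1 ≤ 2 * N := by exact_mod_cast hj
    rw [hstep j hj]
    refine (hBV.abs_integral_le (by positivity) (by gcongr; linarith) ?_).trans_eq (by ring)
    rw [← mul_div_assoc, div_le_iff₀ hN0]; nlinarith
  obtain ⟨m, hm⟩ : ∃ m, 2 * N = m + 1 := ⟨2 * N - 1, by omega⟩
  have hmR : (m : ℝ) + 1 = 2 * N := by exact_mod_cast hm.symm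
  rw [hm, Finset.sum_range_succ]
  have hend : (0 : ℝ) + (m + 1) * (π / N) = 2 * π := by rw [zero_add, hmR]; field_simp
  have hmain := BoundedVariationOn.sum_abs_integral_sub_le (v := v) (a := 0) (h := π / N)
    (by positivity) m (by rwa [hend])
  rw [hend, ← hV] at hmain
  have hlast : |u₀ (node N (m + 2)) - 2 * u₀ (node N (m + 1)) + u₀ (node N m)|
      ≤ 2 * ((|v 0| + V) * (π / N)) := by
    have p1 : u₀ (node N (m + 2)) = u₀ (node N 1) := by
      rw [show m + 2 = 1 + 2 * N by omega, node_add_two_mul hN, hper]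
    have p0 : u₀ (node N (m + 1)) = u₀ (node N 0) := by
      rw [show m + 1 = 0 + 2 * N by omega, node_add_two_mul hN, hper]
    have b1 := hbound 0 (by omega)
    have b2 := hbound m (by omega)
    rw [zero_add] at b1
    rw [show u₀ (node N (m + 2)) - 2 * u₀ (node N (m + 1)) + u₀ (node N m)
      = (u₀ (node N 1) - u₀ (node N 0)) - (u₀ (node N (m + 1)) - u₀ (node N m)) by
        rw [p1, p0]; ring]
    exact (abs_sub _ _).trans (by linarith)
  have hsum : ∑ j ∈ Finset.range m,
      |u₀ (node N (j + 2)) - 2 * u₀ (node N (j + 1)) + u₀ (node N j)| ≤ V * (π / N) := by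
    refine le_trans (Finset.sum_le_sum fun j hj => le_of_eq ?_) hmain
    have hj := Finset.mem_range.1 hj
    have s0 := hstep j (by omega)
    have s1 : u₀ (node N (j + 2)) - u₀ (node N (j + 1))
        = ∫ t in ((j + 1) * (π / N))..((j + 2) * (π / N)), v t := by
      rw [hstep (j + 1) (by omega)]
      push_cast
      congr 1
      ring
    rw [zero_add, zero_add, zero_add, ← s0, ← s1]
    congr 1
    ring
  linarith

lemma sum_range_shift_of_periodic {M : Type*} [AddCommMonoid M] {a : ℕ → M} {m : ℕ}
    (ha : a m = a 0) : ∑ j ∈ Finset.range m, a (j + 1) = ∑ j ∈ Finset.range m, a j := by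
  cases m with
  | zero => simp
  | succ n => rw [Finset.sum_range_succ, ha, Finset.sum_range_succ' a]

lemma sin_ne_zero_of_abs_le {N : ℕ} {k : ℤ} (hk0 : k ≠ 0) (hk : |k| ≤ N) :
    sin (k * π / (2 * N)) ≠ 0 := by
  have hkN : |(k : ℝ)| ≤ N := by exact_mod_cast hk
  have hN : (0 : ℝ) < N := (abs_pos.2 (by exact_mod_cast hk0)).trans_le hkN
  have hx : k * π / (2 * N) ≠ 0 := by
    have : (k : ℝ) ≠ 0 := by exact_mod_cast hk0
    positivity
  have hpi := pi_pos
  obtain ⟨h1, h2⟩ := abs_le.1 hkN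
  rw [Ne, sin_eq_zero_iff_of_lt_of_lt]
  · exact hx
  · rw [lt_div_iff₀ (by positivity)]; nlinarith
  · rw [div_lt_iff₀ (by positivity)]; nlinarith

lemma dftCoeff_eq_sum_second_diff {N : ℕ} {u : ℝ → ℂ} (hu : Function.Periodic u (2 * π))
    {k : ℤ} (hk0 : k ≠ 0) (hk : |k| ≤ N) :
    dftCoeff N u k = -(1 / (2 * N : ℂ)) * (invSecondDiffSymbol N k : ℂ) *
      ∑ j ∈ Finset.range (2 * N), (u (node N (j + 2)) - 2 * u (node N (j + 1)) + u (node N j)) *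
        Complex.exp (-(Complex.I * k * node N (j + 1))) := by
  have hN : 1 ≤ N := by
    have := abs_pos.2 hk0
    omega
  have hNC : (N : ℂ) ≠ 0 := by exact_mod_cast (by omega : N ≠ 0)
  set e : ℕ → ℂ := fun j => Complex.exp (-(Complex.I * k * node N j)) with he
  set q : ℂ := Complex.exp (-(Complex.I * k * (π / N))) with hq
  have hq0 : q ≠ 0 := Complex.exp_ne_zero _
  have hstep : ∀ j, e (j + 1) = e j * q := by
    intro j
    simp only [he, hq, ← Complex.exp_add, node]
    congr 1
    push_cast
    ring
  have hper : ∀ j, u (node N (j + 2 * N)) * e (j + 2 * N) = u (node N j) * e j := by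
    intro j
    simp only [he]
    rw [node_add_two_mul hN, hu,
      show -(Complex.I * k * ((node N j + 2 * π : ℝ) : ℂ))
        = -(Complex.I * k * node N j) - k * (2 * π * Complex.I) by push_cast; ring,
      Complex.exp_sub, Complex.exp_int_mul_two_pi_mul_I, div_one]
  set S := ∑ j ∈ Finset.range (2 * N), u (node N j) * e j with hS
  have hS1 : ∑ j ∈ Finset.range (2 * N), u (node N (j + 1)) * e (j + 1) = S :=
    sum_range_shift_of_periodic (a := fun j => u (node N j) * e j) (by simpa using hper 0)
  have hS2 : ∑ j ∈ Finset.range (2 * N), u (node N (j + 2)) * e (j + 2) = S := by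
    rw [← hS1]
    refine sum_range_shift_of_periodic (a := fun j => u (node N (j + 1)) * e (j + 1)) ?_
    have := hper 1
    rwa [add_comm 1 (2 * N)] at this
  have hsum : ∑ j ∈ Finset.range (2 * N),
      (u (node N (j + 2)) - 2 * u (node N (j + 1)) + u (node N j)) * e (j + 1)
        = S * (q⁻¹ - 2 + q) := by
    have : ∀ j, (u (node N (j + 2)) - 2 * u (node N (j + 1)) + u (node N j)) * e (j + 1)
        = q⁻¹ * (u (node N (j + 2)) * e (j + 2)) - 2 * (u (node N (j + 1)) * e (j + 1))
          + q * (u (node N j) * e j) := by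
      intro j
      rw [hstep (j + 1), hstep j]
      field_simp
    simp only [this, Finset.sum_add_distrib, Finset.sum_sub_distrib, ← Finset.mul_sum, hS1, hS2]
    rw [← hS]
    ring
  have hsymbol : q⁻¹ - 2 + q = -4 * (sin (k * π / (2 * N)) : ℂ) ^ 2 := by
    have hcos : q⁻¹ + q = 2 * Complex.cos (2 * (k * π / (2 * N) : ℂ)) := by
      rw [Complex.cos, hq, ← Complex.exp_neg]
      have e1 : -(-(Complex.I * k * (π / N))) = 2 * (k * π / (2 * N) : ℂ) * Complex.I := by
        field_simp
      have e2 : -(Complex.I * k * (π / N)) = -(2 * (k * π / (2 * N) : ℂ)) * Complex.I := by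
        field_simp
      rw [e1, e2]
      ring
    rw [Complex.cos_two_mul, Complex.cos_sq'] at hcos
    push_cast
    linear_combination hcos
  have hsin : (sin (k * π / (2 * N)) : ℂ) ≠ 0 := by
    exact_mod_cast sin_ne_zero_of_abs_le hk0 hk
  change 1 / (2 * N : ℂ) * S = _ * ∑ j ∈ Finset.range (2 * N), _ * e (j + 1)
  rw [hsum, hsymbol, invSecondDiffSymbol]
  push_cast at hsin ⊢
  field_simp

lemma deriv_trigPoly_s6 (N : ℕ) (c : ℤ → ℂ) (x : ℝ) :
    deriv (trigPoly N c) x = ∑ k ∈ Finset.Icc (-(N : ℤ)) ((N : ℤ) - 1),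
      c k * (Complex.I * k * Complex.exp (Complex.I * k * x)) := by
  refine HasDerivAt.deriv ?_
  unfold trigPoly
  refine HasDerivAt.fun_sum fun k _ => HasDerivAt.const_mul _ ?_
  have h := ((hasDerivAt_id (x : ℂ)).const_mul (Complex.I * k)).cexp.comp_ofReal
  simpa [mul_comm] using h

lemma norm_deriv_interp_le {N : ℕ} (hN : 1 ≤ N) {u : ℝ → ℂ} (hu : Function.Periodic u (2 * π))
    (x : ℝ) : ‖deriv (interp N u) x‖ ≤ 5 / 2 * N * ∑ j ∈ Finset.range (2 * N),
      ‖u (node N (j + 2)) - 2 * u (node N (j + 1)) + u (node N j)‖ := by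
  set d : ℕ → ℂ := fun j => u (node N (j + 2)) - 2 * u (node N (j + 1)) + u (node N j) with hd
  have hN0 : (0 : ℝ) < N := by exact_mod_cast hN
  have key : deriv (interp N u) x = -(1 / (2 * N : ℂ)) * ∑ j ∈ Finset.range (2 * N), d j *
      ∑ k ∈ Finset.Icc (-(N : ℤ)) ((N : ℤ) - 1), Complex.I * k * (invSecondDiffSymbol N k : ℂ) *
        Complex.exp (Complex.I * k * ((x - node N (j + 1) : ℝ) : ℂ)) := by
    rw [interp, deriv_trigPoly_s6]
    simp only [Finset.mul_sum]
    rw [Finset.sum_comm]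
    refine Finset.sum_congr rfl fun k hk => ?_
    rcases eq_or_ne k 0 with rfl | hk0
    · simp
    rw [dftCoeff_eq_sum_second_diff hu hk0 (by
      rw [Finset.mem_Icc] at hk; rw [abs_le]; omega), Finset.mul_sum, Finset.sum_mul]
    refine Finset.sum_congr rfl fun j _ => ?_
    rw [show Complex.I * k * ((x - node N (j + 1) : ℝ) : ℂ)
      = -(Complex.I * k * node N (j + 1)) + Complex.I * k * x by push_cast; ring, Complex.exp_add]
    ring
  rw [key, norm_mul]
  have hc : ‖-(1 / (2 * N : ℂ))‖ = 1 / (2 * N) := by simp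
  rw [hc]
  calc _ ≤ 1 / (2 * (N : ℝ)) * (∑ j ∈ Finset.range (2 * N), ‖d j‖ * (5 * (N : ℝ) ^ 2) : ℝ) := by
        gcongr
        refine (norm_sum_le _ _).trans (Finset.sum_le_sum fun j _ => ?_)
        rw [norm_mul]
        gcongr
        exact norm_sum_symbol_mul_exp_le hN _
    _ = _ := by
        rw [← Finset.sum_mul]
        field_simp
        rfl

/-- Sup-norm bound on the derivative of the interpolant of a
piecewise-smooth periodic function. Absolute continuity of `u₀` on `[0,2π]` with a
derivative of bounded variation is expressed by `u₀ x = u₀ 0 + ∫₀ˣ v` with `v` of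
bounded variation on `[0, 2π]`. -/
theorem supnorm_deriv_interp_piecewise_smooth
    (u₀ : ℝ → ℝ) (hper : Function.Periodic u₀ (2 * Real.pi)) (hcont : Continuous u₀)
    (v : ℝ → ℝ) (hBV : BoundedVariationOn v (Set.Icc (0:ℝ) (2 * Real.pi)))
    (hAC : ∀ x ∈ Set.Icc (0:ℝ) (2 * Real.pi), u₀ x = u₀ 0 + ∫ t in (0:ℝ)..x, v t) :
    ∃ K C : ℝ, ∀ N : ℕ, 1 ≤ N →
      supNorm (deriv (interp N (fun y => (u₀ y : ℂ))))
        ≤ K * (N : ℝ) ^ ((3:ℝ)/2) *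
            l2norm (fun x => interp N (fun y => (u₀ y : ℂ)) x - (u₀ x : ℂ)) + C := by
  set V := (eVariationOn v (Set.Icc (0:ℝ) (2 * Real.pi))).toReal with hV
  refine ⟨0, 5 / 2 * π * (2 * |v 0| + 3 * V), fun N hN => ?_⟩
  have hN0 : (0 : ℝ) < N := by exact_mod_cast hN
  rw [zero_mul, zero_mul, zero_add]
  have : Nonempty (Set.Icc (0:ℝ) (2 * Real.pi)) := ⟨⟨0, by simp [pi_pos.le]⟩⟩
  refine ciSup_le fun x => (norm_deriv_interp_le hN (fun y => by simp [hper y]) x.1).trans ?_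
  have hsum := sum_abs_second_diff_le u₀ hper v hBV hAC hN
  rw [← hV] at hsum
  have hcast : ∀ j, ‖(u₀ (node N (j + 2)) : ℂ) - 2 * (u₀ (node N (j + 1)) : ℂ) + (u₀ (node N j) : ℂ)‖
      = |u₀ (node N (j + 2)) - 2 * u₀ (node N (j + 1)) + u₀ (node N j)| := by
    intro j
    rw [← Real.norm_eq_abs, ← Complex.norm_real]
    push_cast
    rfl
  simp only [hcast]
  calc _ ≤ 5 / 2 * N * ((2 * |v 0| + 3 * V) * (π / N)) := by gcongr
    _ = _ := by field_simp

end
end
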